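/- arXiv:1602.04148 — 6 statements merged into one kernel-verified Lean document; each statement's English description precedes it below -/
import Mathlib

section
/- Let F : ℝ² → ℝ be a C¹ function satisfying hypotheses (F+), (F0) and (F∞). Then there exists M > 0 such that |F_s(s,t)| ≤ M(|s| + |t|) and |F_t(s,t)| ≤ M(|s| + |t|) for all (s,t) ∈ ℝ². -/
/-- A continuous function on the plane vanishing at the origin, and negligible with respect to
`|s| + |t|` both at the origin and at infinity, is bounded by a multiple of `|s| + |t|`. -/
theorem exists_abs_le_mul_of_tendsto_div (G : ℝ × ℝ → ℝ) (hG : Continuous G) (h0 : G (0, 0) = 0)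
    (hzero : Filter.Tendsto (fun p : ℝ × ℝ => G p / (|p.1| + |p.2|))
      (nhdsWithin ((0, 0) : ℝ × ℝ) {((0, 0) : ℝ × ℝ)}ᶜ) (nhds 0))
    (hinf : Filter.Tendsto (fun p : ℝ × ℝ => G p / (|p.1| + |p.2|))
      (Filter.comap (fun p : ℝ × ℝ => |p.1| + |p.2|) Filter.atTop) (nhds 0)) :
    ∃ M : ℝ, ∀ p : ℝ × ℝ, |G p| ≤ M * (|p.1| + |p.2|) := by
  have hpos : ∀ p : ℝ × ℝ, p ≠ (0, 0) → 0 < |p.1| + |p.2| := by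
    intro p hp
    by_contra! h
    have h1 := abs_nonneg p.1
    have h2 := abs_nonneg p.2
    exact hp (Prod.ext (abs_eq_zero.1 (by linarith)) (abs_eq_zero.1 (by linarith)))
  have hball : Metric.ball (0 : ℝ) 1 ∈ nhds (0 : ℝ) := Metric.ball_mem_nhds _ one_pos
  obtain ⟨δ, hδ, hδG⟩ := Metric.mem_nhdsWithin_iff.1 (hzero hball)
  obtain ⟨t, ht, htG⟩ := Filter.mem_comap.1 (hinf hball)
  obtain ⟨R, hR⟩ := Filter.mem_atTop_sets.1 ht
  have hK : IsCompact (Metric.closedBall ((0, 0) : ℝ × ℝ) R \ Metric.ball (0, 0) δ) :=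
    (isCompact_closedBall _ _).diff Metric.isOpen_ball
  have hcont : ContinuousOn (fun p : ℝ × ℝ => G p / (|p.1| + |p.2|))
      (Metric.closedBall ((0, 0) : ℝ × ℝ) R \ Metric.ball (0, 0) δ) := by
    refine hG.continuousOn.div (by fun_prop) fun p hp => (hpos p ?_).ne'
    rintro rfl
    exact hp.2 (Metric.mem_ball_self hδ)
  obtain ⟨C, hC⟩ := hK.exists_bound_of_continuousOn hcont
  refine ⟨max 1 C, fun p => ?_⟩
  rcases eq_or_ne p (0, 0) with rfl | hp
  · simp [h0]
  have hN := hpos p hp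
  suffices h : |G p / (|p.1| + |p.2|)| ≤ max 1 C by
    rwa [abs_div, abs_of_pos hN, div_le_iff₀ hN] at h
  by_cases hpδ : p ∈ Metric.ball ((0, 0) : ℝ × ℝ) δ
  · have h := hδG ⟨hpδ, hp⟩
    rw [Set.mem_preimage, mem_ball_zero_iff, Real.norm_eq_abs] at h
    exact h.le.trans (le_max_left _ _)
  by_cases hpR : R ≤ |p.1| + |p.2|
  · have h := htG (hR _ hpR)
    rw [Set.mem_preimage, mem_ball_zero_iff, Real.norm_eq_abs] at h
    exact h.le.trans (le_max_left _ _)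
  · refine (hC p ⟨?_, hpδ⟩).trans (le_max_right _ _)
    have h1 := abs_nonneg p.1
    have h2 := abs_nonneg p.2
    rw [Metric.mem_closedBall, Prod.dist_eq, Real.dist_0_eq_abs, Real.dist_0_eq_abs]
    exact max_le (by linarith) (by linarith)

/-- the partial derivatives have linear growth. -/
theorem stmt_0
    (F Fs Ft : ℝ × ℝ → ℝ)
    (hF : ContDiff ℝ 1 F)
    (hFs : ∀ p : ℝ × ℝ, Fs p = fderiv ℝ F p (1, 0))
    (hFt : ∀ p : ℝ × ℝ, Ft p = fderiv ℝ F p (0, 1))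
    (hFpos : ∀ p : ℝ × ℝ, 0 ≤ F p)
    (hF00 : F (0, 0) = 0)
    (hFne : F ≠ 0)
    (hFs0 : Filter.Tendsto (fun p : ℝ × ℝ => Fs p / (|p.1| + |p.2|))
      (nhdsWithin ((0, 0) : ℝ × ℝ) {((0, 0) : ℝ × ℝ)}ᶜ) (nhds 0))
    (hFt0 : Filter.Tendsto (fun p : ℝ × ℝ => Ft p / (|p.1| + |p.2|))
      (nhdsWithin ((0, 0) : ℝ × ℝ) {((0, 0) : ℝ × ℝ)}ᶜ) (nhds 0))
    (hFsInf : Filter.Tendsto (fun p : ℝ × ℝ => Fs p / (|p.1| + |p.2|))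
      (Filter.comap (fun p : ℝ × ℝ => |p.1| + |p.2|) Filter.atTop) (nhds 0))
    (hFtInf : Filter.Tendsto (fun p : ℝ × ℝ => Ft p / (|p.1| + |p.2|))
      (Filter.comap (fun p : ℝ × ℝ => |p.1| + |p.2|) Filter.atTop) (nhds 0))
    :
    ∃ M : ℝ, 0 < M ∧ ∀ p : ℝ × ℝ,
      |Fs p| ≤ M * (|p.1| + |p.2|) ∧ |Ft p| ≤ M * (|p.1| + |p.2|) := by
  have hmin : IsLocalMin F (0, 0) := Filter.Eventually.of_forall fun p => hF00.le.trans (hFpos p)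
  have hF' : Continuous (fderiv ℝ F) := hF.continuous_fderiv one_ne_zero
  have hFsc : Continuous Fs := by rw [funext hFs]; fun_prop
  have hFtc : Continuous Ft := by rw [funext hFt]; fun_prop
  obtain ⟨A, hA⟩ := exists_abs_le_mul_of_tendsto_div Fs hFsc
    (by rw [hFs, hmin.fderiv_eq_zero]; rfl) hFs0 hFsInf
  obtain ⟨B, hB⟩ := exists_abs_le_mul_of_tendsto_div Ft hFtc
    (by rw [hFt, hmin.fderiv_eq_zero]; rfl) hFt0 hFtInf
  refine ⟨max 1 (max A B), lt_max_of_lt_left one_pos, fun p => ⟨(hA p).trans ?_, (hB p).trans ?_⟩⟩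
  · gcongr
    exact (le_max_left A B).trans (le_max_right _ _)
  · gcongr
    exact (le_max_right A B).trans (le_max_right _ _)
end

section
/- Let F : ℝ² → ℝ be a C¹ function satisfying hypotheses (F+), (F0) and (F∞). Then there exists c > 0 such that 0 ≤ F(s,t) ≤ c(s² + t²) for all (s,t) ∈ ℝ², i.e., F has subquadratic growth. -/
/-- A continuous function on the plane which is `o(|s| + |t|)` both at the origin and at infinity
is globally `O(|s| + |t|)`. -/
theorem exists_abs_le_mul_abs_add_abs {G : ℝ × ℝ → ℝ} (hG : Continuous G)
    (h0 : Filter.Tendsto (fun p : ℝ × ℝ => G p / (|p.1| + |p.2|))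
      (nhdsWithin ((0, 0) : ℝ × ℝ) {((0, 0) : ℝ × ℝ)}ᶜ) (nhds 0))
    (hInf : Filter.Tendsto (fun p : ℝ × ℝ => G p / (|p.1| + |p.2|))
      (Filter.comap (fun p : ℝ × ℝ => |p.1| + |p.2|) Filter.atTop) (nhds 0)) :
    ∃ C : ℝ, 0 < C ∧ ∀ p : ℝ × ℝ, |G p| ≤ C * (|p.1| + |p.2|) := by
  have norm_le (p : ℝ × ℝ) : ‖p‖ ≤ |p.1| + |p.2| := by
    rw [Prod.norm_def, Real.norm_eq_abs, Real.norm_eq_abs]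
    exact max_le (by linarith [abs_nonneg p.2]) (by linarith [abs_nonneg p.1])
  have le_of_ratio {p : ℝ × ℝ} (hp : p ≠ 0) (h : |G p / (|p.1| + |p.2|)| < 1) :
      |G p| ≤ |p.1| + |p.2| := by
    have hpos : 0 < |p.1| + |p.2| := (norm_pos_iff.2 hp).trans_le (norm_le p)
    rw [abs_div, abs_of_pos hpos, div_lt_one hpos] at h
    exact h.le
  have ev : ∀ᶠ x : ℝ in nhds 0, |x| < 1 :=
    (continuous_abs.tendsto' 0 0 abs_zero).eventually (gt_mem_nhds one_pos)
  obtain ⟨δ, hδ, hnear⟩ := Metric.eventually_nhds_iff.1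
    (eventually_nhdsWithin_iff.1 (h0.eventually ev))
  obtain ⟨R, hfar⟩ := Filter.eventually_atTop.1 (Filter.eventually_comap.1 (hInf.eventually ev))
  obtain ⟨M, hM⟩ := (isCompact_closedBall (0 : ℝ × ℝ) R).exists_bound_of_continuousOn
    hG.continuousOn
  refine ⟨1 + |M| / δ, by positivity, fun p => ?_⟩
  have hclosed : IsClosed {p : ℝ × ℝ | |G p| ≤ (1 + |M| / δ) * (|p.1| + |p.2|)} :=
    isClosed_le (by fun_prop) (by fun_prop)
  refine hclosed.closure_subset_iff.2 ?_ (dense_compl_singleton (0 : ℝ × ℝ) p)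
  intro p (hp : p ≠ 0)
  have hsum : 0 ≤ |p.1| + |p.2| := by positivity
  have hMδ : 0 ≤ |M| / δ := by positivity
  change |G p| ≤ (1 + |M| / δ) * (|p.1| + |p.2|)
  by_cases h1 : ‖p‖ < δ
  · have := le_of_ratio hp (hnear (by simpa [← Prod.zero_eq_mk] using h1) hp)
    nlinarith
  by_cases h2 : R ≤ |p.1| + |p.2|
  · have := le_of_ratio hp (hfar _ h2 p rfl)
    nlinarith
  have hle : |G p| ≤ M := hM p (by simpa using (norm_le p).trans (not_le.1 h2).le)
  have hδp : δ ≤ |p.1| + |p.2| := (not_lt.1 h1).trans (norm_le p)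
  calc |G p| ≤ |M| / δ * δ := by rw [div_mul_cancel₀ _ hδ.ne']; exact hle.trans (le_abs_self M)
    _ ≤ (1 + |M| / δ) * (|p.1| + |p.2|) := by gcongr; linarith

/-- F has subquadratic growth. -/
theorem stmt_1
    (F Fs Ft : ℝ × ℝ → ℝ)
    (hF : ContDiff ℝ 1 F)
    (hFs : ∀ p : ℝ × ℝ, Fs p = fderiv ℝ F p (1, 0))
    (hFt : ∀ p : ℝ × ℝ, Ft p = fderiv ℝ F p (0, 1))
    (hFpos : ∀ p : ℝ × ℝ, 0 ≤ F p)
    (hF00 : F (0, 0) = 0)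
    (hFne : F ≠ 0)
    (hFs0 : Filter.Tendsto (fun p : ℝ × ℝ => Fs p / (|p.1| + |p.2|))
      (nhdsWithin ((0, 0) : ℝ × ℝ) {((0, 0) : ℝ × ℝ)}ᶜ) (nhds 0))
    (hFt0 : Filter.Tendsto (fun p : ℝ × ℝ => Ft p / (|p.1| + |p.2|))
      (nhdsWithin ((0, 0) : ℝ × ℝ) {((0, 0) : ℝ × ℝ)}ᶜ) (nhds 0))
    (hFsInf : Filter.Tendsto (fun p : ℝ × ℝ => Fs p / (|p.1| + |p.2|))
      (Filter.comap (fun p : ℝ × ℝ => |p.1| + |p.2|) Filter.atTop) (nhds 0))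
    (hFtInf : Filter.Tendsto (fun p : ℝ × ℝ => Ft p / (|p.1| + |p.2|))
      (Filter.comap (fun p : ℝ × ℝ => |p.1| + |p.2|) Filter.atTop) (nhds 0))
    :
    ∃ c : ℝ, 0 < c ∧ ∀ p : ℝ × ℝ, 0 ≤ F p ∧ F p ≤ c * (p.1 ^ 2 + p.2 ^ 2) := by
  have hcont : Continuous (fderiv ℝ F) := hF.continuous_fderiv one_ne_zero
  have hFs_cont : Continuous Fs := by
    rw [funext hFs]
    exact hcont.clm_apply continuous_const
  have hFt_cont : Continuous Ft := by
    rw [funext hFt]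
    exact hcont.clm_apply continuous_const
  obtain ⟨A, hA, hFsA⟩ := exists_abs_le_mul_abs_add_abs hFs_cont hFs0 hFsInf
  obtain ⟨B, hB, hFtB⟩ := exists_abs_le_mul_abs_add_abs hFt_cont hFt0 hFtInf
  have abs_fst_le (x : ℝ × ℝ) : |x.1| ≤ ‖x‖ := norm_fst_le x
  have abs_snd_le (x : ℝ × ℝ) : |x.2| ≤ ‖x‖ := norm_snd_le x
  have fderiv_bound (x : ℝ × ℝ) : ‖fderiv ℝ F x‖ ≤ (A + B) * (2 * ‖x‖) := by
    refine ContinuousLinearMap.opNorm_le_bound _ (by positivity) fun v => ?_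
    have hv : fderiv ℝ F x v = v.1 * Fs x + v.2 * Ft x := by
      rw [hFs, hFt, ← smul_eq_mul, ← smul_eq_mul, ← map_smul, ← map_smul, ← map_add]
      simp
    have hsum : |x.1| + |x.2| ≤ 2 * ‖x‖ := by linarith [abs_fst_le x, abs_snd_le x]
    calc ‖fderiv ℝ F x v‖ ≤ |v.1| * |Fs x| + |v.2| * |Ft x| := by
          rw [hv, Real.norm_eq_abs, ← abs_mul, ← abs_mul]
          exact abs_add_le _ _
      _ ≤ ‖v‖ * (A * (2 * ‖x‖)) + ‖v‖ * (B * (2 * ‖x‖)) := by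
          gcongr
          · exact abs_fst_le v
          · exact (hFsA x).trans (by gcongr)
          · exact abs_snd_le v
          · exact (hFtB x).trans (by gcongr)
      _ = (A + B) * (2 * ‖x‖) * ‖v‖ := by ring
  refine ⟨2 * (A + B), by positivity, fun p => ⟨hFpos p, ?_⟩⟩
  have hmv : ‖F p - F 0‖ ≤ (A + B) * (2 * ‖p‖) * ‖p - 0‖ :=
    (convex_closedBall (0 : ℝ × ℝ) ‖p‖).norm_image_sub_le_of_norm_fderiv_le
      (fun x _ => hF.differentiable one_ne_zero x)
      (fun x hx => (fderiv_bound x).trans (by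
        have : ‖x‖ ≤ ‖p‖ := by simpa using hx
        gcongr))
      (by simp) (by simp)
  rw [Prod.zero_eq_mk, hF00, ← Prod.zero_eq_mk, sub_zero, sub_zero] at hmv
  have hsq : ‖p‖ ^ 2 ≤ p.1 ^ 2 + p.2 ^ 2 := by
    rw [Prod.norm_def, Real.norm_eq_abs, Real.norm_eq_abs]
    rcases max_choice |p.1| |p.2| with h | h <;> rw [h, sq_abs]
    · linarith [sq_nonneg p.2]
    · linarith [sq_nonneg p.1]
  calc F p ≤ (A + B) * (2 * ‖p‖) * ‖p‖ := (le_abs_self _).trans hmv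
    _ = 2 * (A + B) * ‖p‖ ^ 2 := by ring
    _ ≤ 2 * (A + B) * (p.1 ^ 2 + p.2 ^ 2) := by gcongr
end

section
/- Let F : ℝ² → ℝ be a C¹ function satisfying hypotheses (F+), (F0) and (F∞). Then F(s,t)/(s² + t²) → 0 as |s| + |t| → ∞. -/
open Filter Topology Asymptotics

/-- If the derivative of a `C¹` function grows sublinearly, the function grows subquadratically. -/
theorem isLittleO_norm_sq_of_fderiv_isLittleO {E : Type*} [NormedAddCommGroup E]
    [NormedSpace ℝ E] [ProperSpace E] {f : E → ℝ} (hf : ContDiff ℝ 1 f)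
    (h : fderiv ℝ f =o[cocompact E] fun x => ‖x‖) :
    f =o[cocompact E] fun x => ‖x‖ ^ 2 := by
  rw [isLittleO_iff]
  intro ε hε
  have hev := (isLittleO_iff.mp h) (half_pos hε)
  obtain ⟨K, hK, hKs⟩ := mem_cocompact.mp hev
  obtain ⟨C, hC⟩ := hK.exists_bound_of_continuousOn
    (hf.continuous_fderiv one_ne_zero).continuousOn
  have hbound : ∀ x, ‖fderiv ℝ f x‖ ≤ ε / 2 * ‖x‖ + |C| := by
    intro x
    by_cases hx : x ∈ K
    · have := hC x hx
      have : 0 ≤ ε / 2 * ‖x‖ := by positivity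
      linarith [le_abs_self C]
    · have hx' : ‖fderiv ℝ f x‖ ≤ ε / 2 * ‖‖x‖‖ := hKs hx
      rw [norm_norm] at hx'
      linarith [abs_nonneg C]
  have hgrowth : ∀ x, ‖f x - f 0‖ ≤ (ε / 2 * ‖x‖ + |C|) * ‖x‖ := by
    intro x
    have := (convex_closedBall (0 : E) ‖x‖).norm_image_sub_le_of_norm_fderiv_le (𝕜 := ℝ)
      (fun y _ => hf.differentiable one_ne_zero y)
      (C := ε / 2 * ‖x‖ + |C|) (fun y hy => (hbound y).trans (by
        have : ‖y‖ ≤ ‖x‖ := by simpa using hy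
        gcongr))
      (Metric.mem_closedBall_self (norm_nonneg x)) (y := x) (by simp)
    simpa using this
  filter_upwards [tendsto_norm_cocompact_atTop.eventually_ge_atTop
    (max 1 (2 / ε * (|C| + ‖f 0‖)))] with x hx
  have h1 : 1 ≤ ‖x‖ := (le_max_left _ _).trans hx
  have h2 : |C| + ‖f 0‖ ≤ ε / 2 * ‖x‖ := by
    have := (le_max_right _ _).trans hx
    calc |C| + ‖f 0‖ = ε / 2 * (2 / ε * (|C| + ‖f 0‖)) := by field_simp
      _ ≤ ε / 2 * ‖x‖ := by gcongr
  have h3 := norm_le_norm_add_norm_sub' (f x) (f 0)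
  rw [norm_pow, norm_norm]
  nlinarith [hgrowth x, norm_nonneg (f 0), mul_le_mul_of_nonneg_right h2 (norm_nonneg x),
    mul_le_mul_of_nonneg_left h1 (norm_nonneg (f 0))]

theorem comap_abs_add_abs_atTop :
    comap (fun p : ℝ × ℝ => |p.1| + |p.2|) atTop = cocompact (ℝ × ℝ) := by
  rw [← Metric.cobounded_eq_cocompact, ← comap_norm_atTop]
  apply le_antisymm
  · refine tendsto_iff_comap.mp (tendsto_atTop_mono (fun p => ?_)
      (tendsto_comap.const_mul_atTop (one_half_pos (α := ℝ))))
    have h1 : |p.1| ≤ ‖p‖ := norm_fst_le p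
    have h2 : |p.2| ≤ ‖p‖ := norm_snd_le p
    linarith
  · refine tendsto_iff_comap.mp (tendsto_atTop_mono (fun p => ?_) tendsto_comap)
    rw [Prod.norm_def]
    exact max_le (le_add_of_nonneg_right (abs_nonneg _)) (le_add_of_nonneg_left (abs_nonneg _))

theorem norm_le_abs_apply_add_abs_apply (L : ℝ × ℝ →L[ℝ] ℝ) :
    ‖L‖ ≤ |L (1, 0)| + |L (0, 1)| := by
  refine L.opNorm_le_bound (by positivity) fun p => ?_
  have hp : L p = p.1 * L (1, 0) + p.2 * L (0, 1) := by
    rw [← smul_eq_mul, ← smul_eq_mul, ← map_smul, ← map_smul, ← map_add]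
    simp
  have h1 : |p.1| ≤ ‖p‖ := norm_fst_le p
  have h2 : |p.2| ≤ ‖p‖ := norm_snd_le p
  calc ‖L p‖ ≤ |p.1| * |L (1, 0)| + |p.2| * |L (0, 1)| := by
        rw [hp, ← abs_mul, ← abs_mul]; exact abs_add_le _ _
    _ ≤ ‖p‖ * |L (1, 0)| + ‖p‖ * |L (0, 1)| := by gcongr
    _ = (|L (1, 0)| + |L (0, 1)|) * ‖p‖ := by ring

/-- F(s,t)/(s²+t²) → 0 as |s|+|t| → ∞. -/
theorem stmt_3
    (F Fs Ft : ℝ × ℝ → ℝ)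
    (hF : ContDiff ℝ 1 F)
    (hFs : ∀ p : ℝ × ℝ, Fs p = fderiv ℝ F p (1, 0))
    (hFt : ∀ p : ℝ × ℝ, Ft p = fderiv ℝ F p (0, 1))
    (hFpos : ∀ p : ℝ × ℝ, 0 ≤ F p)
    (hF00 : F (0, 0) = 0)
    (hFne : F ≠ 0)
    (hFs0 : Filter.Tendsto (fun p : ℝ × ℝ => Fs p / (|p.1| + |p.2|))
      (nhdsWithin ((0, 0) : ℝ × ℝ) {((0, 0) : ℝ × ℝ)}ᶜ) (nhds 0))
    (hFt0 : Filter.Tendsto (fun p : ℝ × ℝ => Ft p / (|p.1| + |p.2|))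
      (nhdsWithin ((0, 0) : ℝ × ℝ) {((0, 0) : ℝ × ℝ)}ᶜ) (nhds 0))
    (hFsInf : Filter.Tendsto (fun p : ℝ × ℝ => Fs p / (|p.1| + |p.2|))
      (Filter.comap (fun p : ℝ × ℝ => |p.1| + |p.2|) Filter.atTop) (nhds 0))
    (hFtInf : Filter.Tendsto (fun p : ℝ × ℝ => Ft p / (|p.1| + |p.2|))
      (Filter.comap (fun p : ℝ × ℝ => |p.1| + |p.2|) Filter.atTop) (nhds 0))
    :
    Filter.Tendsto (fun p : ℝ × ℝ => F p / (p.1 ^ 2 + p.2 ^ 2))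
      (Filter.comap (fun p : ℝ × ℝ => |p.1| + |p.2|) Filter.atTop) (nhds 0) := by
  rw [comap_abs_add_abs_atTop] at *
  have hne : ∀ᶠ p : ℝ × ℝ in cocompact (ℝ × ℝ), p ≠ 0 := by
    filter_upwards [(isCompact_singleton (x := (0 : ℝ × ℝ))).compl_mem_cocompact] with p hp
    exact hp
  have hsum : ∀ᶠ p : ℝ × ℝ in cocompact (ℝ × ℝ), |p.1| + |p.2| ≠ 0 := by
    filter_upwards [hne] with p hp h0
    have h1 := abs_nonneg p.1
    have h2 := abs_nonneg p.2
    exact hp (Prod.ext (abs_eq_zero.mp (by linarith)) (abs_eq_zero.mp (by linarith)))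
  have hN : (fun p : ℝ × ℝ => |p.1| + |p.2|) =O[cocompact (ℝ × ℝ)] fun p => ‖p‖ :=
    (IsBigO.of_norm_le (g := fun p => ‖p‖) fun p : ℝ × ℝ => by
      simpa using norm_fst_le p).add
    (IsBigO.of_norm_le fun p : ℝ × ℝ => by simpa using norm_snd_le p)
  have hs : Fs =o[cocompact (ℝ × ℝ)] fun p => ‖p‖ :=
    ((isLittleO_iff_tendsto' (hsum.mono fun _ h h0 => absurd h0 h)).mpr hFsInf).trans_isBigO hN
  have ht : Ft =o[cocompact (ℝ × ℝ)] fun p => ‖p‖ :=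
    ((isLittleO_iff_tendsto' (hsum.mono fun _ h h0 => absurd h0 h)).mpr hFtInf).trans_isBigO hN
  have hD : fderiv ℝ F =o[cocompact (ℝ × ℝ)] fun p => ‖p‖ := by
    refine (IsBigO.of_bound 1 (Eventually.of_forall fun p => ?_)).trans_isLittleO
      (hs.norm_left.add ht.norm_left)
    have h := norm_le_abs_apply_add_abs_apply (fderiv ℝ F p)
    rw [← hFs, ← hFt] at h
    rw [one_mul]
    exact h.trans (le_abs_self _)
  refine ((isLittleO_norm_sq_of_fderiv_isLittleO hF hD).trans_isBigO
    (IsBigO.of_bound 1 (Eventually.of_forall fun p => ?_))).tendsto_div_nhds_zero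
  rw [one_mul, norm_pow, norm_norm, Real.norm_of_nonneg (by positivity), Prod.norm_def]
  rcases max_choice ‖p.1‖ ‖p.2‖ with h | h <;> rw [h, Real.norm_eq_abs, sq_abs]
  · exact le_add_of_nonneg_right (sq_nonneg _)
  · exact le_add_of_nonneg_left (sq_nonneg _)
end

section
/- Let F : ℝ² → ℝ be a C¹ function satisfying hypotheses (F+), (F0) and (F∞), and let p > 2. Then for every ε > 0 there exists m > 0 such that 0 ≤ F(s,t) ≤ ε(s² + t²) + m(|s|^p + |t|^p) for all (s,t) ∈ ℝ². -/
lemma norm_le_mul_norm_of_norm_fderiv_le {E : Type*} [NormedAddCommGroup E] [NormedSpace ℝ E]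
    {F : E → ℝ} (hF : Differentiable ℝ F) (hF0 : F 0 = 0) {C : ℝ} {p : E}
    (hC : ∀ x, ‖x‖ ≤ ‖p‖ → ‖fderiv ℝ F x‖ ≤ C) : ‖F p‖ ≤ C * ‖p‖ := by
  have h := (convex_closedBall (0 : E) ‖p‖).norm_image_sub_le_of_norm_fderiv_le (𝕜 := ℝ) (f := F)
    (C := C) (x := 0) (y := p) (fun x _ => hF x)
    (fun x hx => hC x (by simpa using hx)) (by simp) (by simp)
  simpa [hF0] using h

lemma norm_le_of_abs_apply_le {L : ℝ × ℝ →L[ℝ] ℝ} {a b : ℝ}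
    (h₁ : |L (1, 0)| ≤ a) (h₂ : |L (0, 1)| ≤ b) : ‖L‖ ≤ a + b := by
  have ha : 0 ≤ a := (abs_nonneg _).trans h₁
  have hb : 0 ≤ b := (abs_nonneg _).trans h₂
  refine L.opNorm_le_bound (add_nonneg ha hb) fun v => ?_
  have hv : v = v.1 • ((1, 0) : ℝ × ℝ) + v.2 • ((0, 1) : ℝ × ℝ) := by ext <;> simp
  have hLv : L v = v.1 * L (1, 0) + v.2 * L (0, 1) := by
    conv_lhs => rw [hv]
    simp only [map_add, map_smul, smul_eq_mul]
  have hv₁ : |v.1| ≤ ‖v‖ := norm_fst_le v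
  have hv₂ : |v.2| ≤ ‖v‖ := norm_snd_le v
  calc ‖L v‖ ≤ |v.1| * |L (1, 0)| + |v.2| * |L (0, 1)| := by
        rw [hLv, Real.norm_eq_abs, ← abs_mul, ← abs_mul]
        exact abs_add_le _ _
    _ ≤ ‖v‖ * a + ‖v‖ * b := by gcongr
    _ = (a + b) * ‖v‖ := by ring

lemma norm_fderiv_le_of_abs_div_lt {F : ℝ × ℝ → ℝ} {x : ℝ × ℝ} {η : ℝ} (hx : x ≠ 0)
    (h₁ : |fderiv ℝ F x (1, 0) / (|x.1| + |x.2|)| < η)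
    (h₂ : |fderiv ℝ F x (0, 1) / (|x.1| + |x.2|)| < η) :
    ‖fderiv ℝ F x‖ ≤ 4 * η * ‖x‖ := by
  have hη : 0 < η := (abs_nonneg _).trans_lt h₁
  have hx₁ : |x.1| ≤ ‖x‖ := norm_fst_le x
  have hx₂ : |x.2| ≤ ‖x‖ := norm_snd_le x
  have hpos : 0 < |x.1| + |x.2| := by
    refine lt_of_lt_of_le (norm_pos_iff.2 hx) ?_
    rw [Prod.norm_def]
    exact max_le_add_of_nonneg (norm_nonneg _) (norm_nonneg _)
  have key : ∀ y : ℝ, |y / (|x.1| + |x.2|)| < η → |y| ≤ 2 * η * ‖x‖ := by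
    intro y hy
    rw [abs_div, abs_of_pos hpos, div_lt_iff₀ hpos] at hy
    nlinarith
  have h := norm_le_of_abs_apply_le (key _ h₁) (key _ h₂)
  linarith

lemma exists_norm_fderiv_le_near_zero {F : ℝ × ℝ → ℝ}
    (h₁ : Filter.Tendsto (fun p : ℝ × ℝ => fderiv ℝ F p (1, 0) / (|p.1| + |p.2|))
      (nhdsWithin 0 {0}ᶜ) (nhds 0))
    (h₂ : Filter.Tendsto (fun p : ℝ × ℝ => fderiv ℝ F p (0, 1) / (|p.1| + |p.2|))
      (nhdsWithin 0 {0}ᶜ) (nhds 0)) {η : ℝ} (hη : 0 < η) :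
    ∃ δ > 0, ∀ x : ℝ × ℝ, x ≠ 0 → ‖x‖ < δ → ‖fderiv ℝ F x‖ ≤ 4 * η * ‖x‖ := by
  have h := (Metric.tendsto_nhds.1 h₁ η hη).and (Metric.tendsto_nhds.1 h₂ η hη)
  obtain ⟨δ, hδ, hball⟩ := Metric.mem_nhdsWithin_iff.1 h
  refine ⟨δ, hδ, fun x hx hxδ => ?_⟩
  obtain ⟨hs, ht⟩ := hball ⟨by simpa using hxδ, hx⟩
  rw [Real.dist_0_eq_abs] at hs ht
  exact norm_fderiv_le_of_abs_div_lt hx hs ht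

lemma exists_norm_fderiv_le_add {F : ℝ × ℝ → ℝ} (hF : ContDiff ℝ 1 F)
    (h₁ : Filter.Tendsto (fun p : ℝ × ℝ => fderiv ℝ F p (1, 0) / (|p.1| + |p.2|))
      (Filter.comap (fun p : ℝ × ℝ => |p.1| + |p.2|) Filter.atTop) (nhds 0))
    (h₂ : Filter.Tendsto (fun p : ℝ × ℝ => fderiv ℝ F p (0, 1) / (|p.1| + |p.2|))
      (Filter.comap (fun p : ℝ × ℝ => |p.1| + |p.2|) Filter.atTop) (nhds 0)) :
    ∃ M, 0 ≤ M ∧ ∀ x : ℝ × ℝ, ‖fderiv ℝ F x‖ ≤ M + 4 * ‖x‖ := by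
  have h := (Metric.tendsto_nhds.1 h₁ 1 one_pos).and (Metric.tendsto_nhds.1 h₂ 1 one_pos)
  obtain ⟨R, hR⟩ := Filter.eventually_atTop.1 (Filter.eventually_comap.1 h)
  obtain ⟨M, hM⟩ := (isCompact_closedBall (0 : ℝ × ℝ) (max R 0)).exists_bound_of_continuousOn
    (hF.continuous_fderiv one_ne_zero).continuousOn
  have hM0 : 0 ≤ M := (norm_nonneg _).trans (hM 0 (by simp))
  refine ⟨M, hM0, fun x => ?_⟩
  rcases le_or_gt ‖x‖ (max R 0) with hx | hx
  · have := hM x (by simpa using hx)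
    linarith [norm_nonneg x]
  · have hx0 : x ≠ 0 := norm_pos_iff.1 ((le_max_right R 0).trans_lt hx)
    have hRx : R ≤ |x.1| + |x.2| := by
      refine ((le_max_left R 0).trans hx.le).trans ?_
      rw [Prod.norm_def]
      exact max_le_add_of_nonneg (norm_nonneg _) (norm_nonneg _)
    obtain ⟨hs, ht⟩ := hR _ hRx x rfl
    rw [Real.dist_0_eq_abs] at hs ht
    linarith [norm_fderiv_le_of_abs_div_lt hx0 hs ht]

lemma apply_norm_le_add_of_nonneg {f : ℝ → ℝ} (hf : ∀ x, 0 ≤ x → 0 ≤ f x) (p : ℝ × ℝ) :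
    f ‖p‖ ≤ f |p.1| + f |p.2| := by
  have h₁ := hf _ (abs_nonneg p.1)
  have h₂ := hf _ (abs_nonneg p.2)
  rw [Prod.norm_def]
  rcases max_choice ‖p.1‖ ‖p.2‖ with h | h <;> rw [h, Real.norm_eq_abs] <;> linarith

/-- superquadratic-power splitting estimate for F, p > 2. -/
theorem stmt_9
    (F Fs Ft : ℝ × ℝ → ℝ)
    (hF : ContDiff ℝ 1 F)
    (hFs : ∀ p : ℝ × ℝ, Fs p = fderiv ℝ F p (1, 0))
    (hFt : ∀ p : ℝ × ℝ, Ft p = fderiv ℝ F p (0, 1))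
    (hFpos : ∀ p : ℝ × ℝ, 0 ≤ F p)
    (hF00 : F (0, 0) = 0)
    (hFne : F ≠ 0)
    (hFs0 : Filter.Tendsto (fun p : ℝ × ℝ => Fs p / (|p.1| + |p.2|))
      (nhdsWithin ((0, 0) : ℝ × ℝ) {((0, 0) : ℝ × ℝ)}ᶜ) (nhds 0))
    (hFt0 : Filter.Tendsto (fun p : ℝ × ℝ => Ft p / (|p.1| + |p.2|))
      (nhdsWithin ((0, 0) : ℝ × ℝ) {((0, 0) : ℝ × ℝ)}ᶜ) (nhds 0))
    (hFsInf : Filter.Tendsto (fun p : ℝ × ℝ => Fs p / (|p.1| + |p.2|))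
      (Filter.comap (fun p : ℝ × ℝ => |p.1| + |p.2|) Filter.atTop) (nhds 0))
    (hFtInf : Filter.Tendsto (fun p : ℝ × ℝ => Ft p / (|p.1| + |p.2|))
      (Filter.comap (fun p : ℝ × ℝ => |p.1| + |p.2|) Filter.atTop) (nhds 0))
    (q : ℝ) (hq : 2 < q)
    :
    ∀ ε : ℝ, 0 < ε → ∃ m : ℝ, 0 < m ∧ ∀ p : ℝ × ℝ,
      0 ≤ F p ∧ F p ≤ ε * (p.1 ^ 2 + p.2 ^ 2) + m * (|p.1| ^ q + |p.2| ^ q) := by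
  intro ε hε
  obtain rfl : Fs = fun p => fderiv ℝ F p (1, 0) := funext hFs
  obtain rfl : Ft = fun p => fderiv ℝ F p (0, 1) := funext hFt
  have hdiff : Differentiable ℝ F := hF.differentiable one_ne_zero
  obtain ⟨δ, hδ, hnear⟩ := exists_norm_fderiv_le_near_zero hFs0 hFt0 (η := ε / 4) (by positivity)
  obtain ⟨M, hM, hglobal⟩ := exists_norm_fderiv_le_add hF hFsInf hFtInf
  refine ⟨(M / δ + 4) * δ ^ (2 - q), by positivity, fun p => ⟨hFpos p, ?_⟩⟩
  have hsq : ‖p‖ ^ 2 ≤ p.1 ^ 2 + p.2 ^ 2 := by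
    simpa using apply_norm_le_add_of_nonneg (f := fun x => x ^ 2) (fun x _ => sq_nonneg x) p
  have hrpow : ‖p‖ ^ q ≤ |p.1| ^ q + |p.2| ^ q :=
    apply_norm_le_add_of_nonneg (f := fun x => x ^ q) (fun x hx => Real.rpow_nonneg hx q) p
  rcases lt_or_ge ‖p‖ δ with hp | hp
  · have hbound : ‖F p‖ ≤ ε * ‖p‖ * ‖p‖ := by
      refine norm_le_mul_norm_of_norm_fderiv_le hdiff hF00 fun x hx => ?_
      rcases eq_or_ne x 0 with rfl | hx0
      · have hmin : IsLocalMin F 0 :=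
          Filter.Eventually.of_forall fun y => (show F 0 = 0 from hF00).trans_le (hFpos y)
        rw [hmin.fderiv_eq_zero, norm_zero]
        positivity
      · have := hnear x hx0 (hx.trans_lt hp)
        nlinarith
    have hFle := (le_abs_self (F p)).trans hbound
    have : 0 ≤ (M / δ + 4) * δ ^ (2 - q) * (|p.1| ^ q + |p.2| ^ q) := by positivity
    nlinarith
  · have hp0 : 0 < ‖p‖ := hδ.trans_le hp
    have hbound : ‖F p‖ ≤ (M + 4 * ‖p‖) * ‖p‖ :=
      norm_le_mul_norm_of_norm_fderiv_le hdiff hF00 fun x hx =>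
        (hglobal x).trans (by linarith)
    have hMp : M ≤ M / δ * ‖p‖ := by
      rw [div_mul_eq_mul_div, le_div_iff₀ hδ]
      gcongr
    have hpow : ‖p‖ ^ 2 ≤ δ ^ (2 - q) * ‖p‖ ^ q := by
      calc ‖p‖ ^ 2 = ‖p‖ ^ (2 - q) * ‖p‖ ^ q := by
            rw [← Real.rpow_add hp0, sub_add_cancel, Real.rpow_two]
        _ ≤ δ ^ (2 - q) * ‖p‖ ^ q := by
            gcongr ?_ * _
            exact Real.rpow_le_rpow_of_nonpos hδ hp (by linarith)
    calc F p ≤ (M + 4 * ‖p‖) * ‖p‖ := (le_abs_self _).trans hbound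
      _ ≤ (M / δ * ‖p‖ + 4 * ‖p‖) * ‖p‖ := by gcongr
      _ = (M / δ + 4) * ‖p‖ ^ 2 := by ring
      _ ≤ (M / δ + 4) * (δ ^ (2 - q) * ‖p‖ ^ q) := by gcongr
      _ ≤ (M / δ + 4) * (δ ^ (2 - q) * (|p.1| ^ q + |p.2| ^ q)) := by gcongr
      _ = (M / δ + 4) * δ ^ (2 - q) * (|p.1| ^ q + |p.2| ^ q) := by ring
      _ ≤ ε * (p.1 ^ 2 + p.2 ^ 2) + (M / δ + 4) * δ ^ (2 - q) * (|p.1| ^ q + |p.2| ^ q) :=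
        le_add_of_nonneg_left (by positivity)
end

section
/- Let F : ℝ² → ℝ be a C¹ function satisfying hypotheses (F+), (F0) and (F∞), and let r ∈ (1,2). Then for every ε > 0 there exists M > 0 such that 0 ≤ F(s,t) ≤ ε(s² + t²) + M(|s|^r + |t|^r) for all (s,t) ∈ ℝ². -/
open Filter Topology

/-- A function that is little-o of the `ℓ¹` norm at the origin and vanishes there is bounded by any
small multiple of that norm near the origin. -/
theorem exists_forall_abs_le_of_tendsto_nhdsWithin {G : ℝ × ℝ → ℝ} (hG : G 0 = 0)
    (h : Tendsto (fun p : ℝ × ℝ => G p / (|p.1| + |p.2|)) (𝓝[{(0, 0)}ᶜ] (0, 0)) (𝓝 0))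
    {δ : ℝ} (hδ : 0 < δ) :
    ∃ a > 0, ∀ q : ℝ × ℝ, |q.1| + |q.2| < a → |G q| ≤ δ * (|q.1| + |q.2|) := by
  obtain ⟨a, ha, h⟩ := Metric.tendsto_nhdsWithin_nhds.1 h δ hδ
  refine ⟨a, ha, fun q hq => ?_⟩
  rcases eq_or_ne q 0 with rfl | hq0
  · simp [hG]
  have hdist : dist q (0, 0) < a := by
    rw [Prod.dist_eq, Real.dist_eq, Real.dist_eq, sub_zero, sub_zero]
    exact max_lt (by linarith [abs_nonneg q.2]) (by linarith [abs_nonneg q.1])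
  have hpos : 0 < |q.1| + |q.2| := by
    by_contra! hle
    apply hq0
    ext
    · exact abs_eq_zero.1 (by linarith [abs_nonneg q.1, abs_nonneg q.2])
    · exact abs_eq_zero.1 (by linarith [abs_nonneg q.1, abs_nonneg q.2])
  have := h hq0 hdist
  rw [Real.dist_eq, sub_zero, abs_div, abs_of_pos hpos, div_lt_iff₀ hpos] at this
  exact this.le

/-- A continuous function that is little-o of the `ℓ¹` norm at infinity is bounded by any small
multiple of that norm plus a constant. -/
theorem exists_forall_abs_le_add_of_tendsto_comap_atTop {G : ℝ × ℝ → ℝ} (hG : Continuous G)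
    (h : Tendsto (fun p : ℝ × ℝ => G p / (|p.1| + |p.2|))
      (comap (fun p : ℝ × ℝ => |p.1| + |p.2|) atTop) (𝓝 0)) {δ : ℝ} (hδ : 0 < δ) :
    ∃ K ≥ 0, ∀ q : ℝ × ℝ, |G q| ≤ δ * (|q.1| + |q.2|) + K := by
  have hev := (Metric.tendsto_nhds.1 h) δ hδ
  rw [eventually_comap] at hev
  obtain ⟨R, hR⟩ := eventually_atTop.1 hev
  obtain ⟨K, hK⟩ := (isCompact_closedBall (0 : ℝ × ℝ) (max R 1)).exists_bound_of_continuousOn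
    hG.continuousOn
  refine ⟨max K 0, le_max_right _ _, fun q => ?_⟩
  have hN : 0 ≤ |q.1| + |q.2| := by positivity
  rcases le_total (max R 1) (|q.1| + |q.2|) with hq | hq
  · have hpos : 0 < |q.1| + |q.2| := by linarith [le_max_right R 1]
    have := hR _ ((le_max_left _ _).trans hq) q rfl
    rw [Real.dist_eq, sub_zero, abs_div, abs_of_pos hpos, div_lt_iff₀ hpos] at this
    linarith [le_max_right K 0]
  · have hmem : q ∈ Metric.closedBall (0 : ℝ × ℝ) (max R 1) := by
      rw [mem_closedBall_zero_iff, Prod.norm_def, Real.norm_eq_abs, Real.norm_eq_abs]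
      exact (max_le (by linarith [abs_nonneg q.2]) (by linarith [abs_nonneg q.1])).trans hq
    have := hK q hmem
    rw [Real.norm_eq_abs] at this
    have := mul_nonneg hδ.le hN
    linarith [le_max_left K 0]

/-- Mean value inequality along the segment from the origin, in terms of partial derivatives. -/
theorem le_mul_of_abs_partial_le {F : ℝ × ℝ → ℝ} (hF : Differentiable ℝ F) (h0 : F 0 = 0)
    {p : ℝ × ℝ} {C : ℝ}
    (hs : ∀ q : ℝ × ℝ, |q.1| + |q.2| ≤ |p.1| + |p.2| → |fderiv ℝ F q (1, 0)| ≤ C)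
    (ht : ∀ q : ℝ × ℝ, |q.1| + |q.2| ≤ |p.1| + |p.2| → |fderiv ℝ F q (0, 1)| ≤ C) :
    F p ≤ C * (|p.1| + |p.2|) := by
  have hderiv : ∀ x ∈ Set.Icc (0 : ℝ) 1,
      HasDerivWithinAt (fun x : ℝ => F (x • p)) (fderiv ℝ F (x • p) p) (Set.Icc 0 1) x := by
    intro x _
    have hline : HasDerivAt (fun x : ℝ => x • p) p x := by
      simpa using (hasDerivAt_id x).smul_const p
    exact ((hF (x • p)).hasFDerivAt.comp_hasDerivAt x hline).hasDerivWithinAt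
  have hbound : ∀ x ∈ Set.Ico (0 : ℝ) 1,
      ‖fderiv ℝ F (x • p) p‖ ≤ C * (|p.1| + |p.2|) := by
    intro x hx
    have hle : |(x • p).1| + |(x • p).2| ≤ |p.1| + |p.2| := by
      simp only [Prod.smul_fst, Prod.smul_snd, smul_eq_mul, abs_mul, abs_of_nonneg hx.1]
      exact add_le_add (mul_le_of_le_one_left (abs_nonneg _) hx.2.le)
        (mul_le_of_le_one_left (abs_nonneg _) hx.2.le)
    have hp : p = p.1 • ((1, 0) : ℝ × ℝ) + p.2 • ((0, 1) : ℝ × ℝ) := by ext <;> simp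
    have hsplit : fderiv ℝ F (x • p) p =
        p.1 * fderiv ℝ F (x • p) (1, 0) + p.2 * fderiv ℝ F (x • p) (0, 1) := by
      conv_lhs => rw [hp, map_add, map_smul, map_smul, ← hp]
      rfl
    rw [hsplit, Real.norm_eq_abs]
    calc _ ≤ |p.1| * |fderiv ℝ F (x • p) (1, 0)| + |p.2| * |fderiv ℝ F (x • p) (0, 1)| := by
          rw [← abs_mul, ← abs_mul]; exact abs_add_le _ _
      _ ≤ |p.1| * C + |p.2| * C := by gcongr; exacts [hs _ hle, ht _ hle]
      _ = _ := by ring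
  have := norm_image_sub_le_of_norm_deriv_le_segment_01' hderiv hbound
  simp only [one_smul, zero_smul, h0, sub_zero, Real.norm_eq_abs] at this
  exact (le_abs_self _).trans this

/-- Away from the origin the `ℓ¹` norm is controlled by the `r`-th powers of the coordinates. -/
theorem abs_add_abs_le_mul_rpow {a r : ℝ} (ha : 0 < a) (hr : 1 ≤ r) {p : ℝ × ℝ}
    (hp : a ≤ |p.1| + |p.2|) :
    |p.1| + |p.2| ≤ 2 * (a / 2) ^ (1 - r) * (|p.1| ^ r + |p.2| ^ r) := by
  have key : ∀ m : ℝ, a / 2 ≤ m → m ≤ (a / 2) ^ (1 - r) * m ^ r := by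
    intro m hm
    have hm0 : 0 < m := by linarith
    calc m = m ^ (1 - r) * m ^ r := by rw [← Real.rpow_add hm0]; simp
      _ ≤ _ := by
        gcongr ?_ * _
        exact Real.rpow_le_rpow_of_nonpos (by linarith) hm (by linarith)
  have hc : 0 ≤ (a / 2) ^ (1 - r) := by positivity
  have h1 : 0 ≤ (a / 2) ^ (1 - r) * |p.1| ^ r := by positivity
  have h2 : 0 ≤ (a / 2) ^ (1 - r) * |p.2| ^ r := by positivity
  rcases le_total |p.1| |p.2| with h | h
  · linarith [key |p.2| (by linarith)]
  · linarith [key |p.1| (by linarith)]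


/-- subquadratic-power splitting estimate for F, r ∈ (1,2). -/
theorem stmt_10
    (F Fs Ft : ℝ × ℝ → ℝ)
    (hF : ContDiff ℝ 1 F)
    (hFs : ∀ p : ℝ × ℝ, Fs p = fderiv ℝ F p (1, 0))
    (hFt : ∀ p : ℝ × ℝ, Ft p = fderiv ℝ F p (0, 1))
    (hFpos : ∀ p : ℝ × ℝ, 0 ≤ F p)
    (hF00 : F (0, 0) = 0)
    (hFne : F ≠ 0)
    (hFs0 : Filter.Tendsto (fun p : ℝ × ℝ => Fs p / (|p.1| + |p.2|))
      (nhdsWithin ((0, 0) : ℝ × ℝ) {((0, 0) : ℝ × ℝ)}ᶜ) (nhds 0))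
    (hFt0 : Filter.Tendsto (fun p : ℝ × ℝ => Ft p / (|p.1| + |p.2|))
      (nhdsWithin ((0, 0) : ℝ × ℝ) {((0, 0) : ℝ × ℝ)}ᶜ) (nhds 0))
    (hFsInf : Filter.Tendsto (fun p : ℝ × ℝ => Fs p / (|p.1| + |p.2|))
      (Filter.comap (fun p : ℝ × ℝ => |p.1| + |p.2|) Filter.atTop) (nhds 0))
    (hFtInf : Filter.Tendsto (fun p : ℝ × ℝ => Ft p / (|p.1| + |p.2|))
      (Filter.comap (fun p : ℝ × ℝ => |p.1| + |p.2|) Filter.atTop) (nhds 0))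
    (r : ℝ) (hr1 : 1 < r) (hr2 : r < 2)
    :
    ∀ ε : ℝ, 0 < ε → ∃ M : ℝ, 0 < M ∧ ∀ p : ℝ × ℝ,
      0 ≤ F p ∧ F p ≤ ε * (p.1 ^ 2 + p.2 ^ 2) + M * (|p.1| ^ r + |p.2| ^ r) := by
  intro ε hε
  have h0 : F 0 = 0 := hF00
  have hdiff : Differentiable ℝ F := hF.differentiable one_ne_zero
  have hcrit : fderiv ℝ F 0 = 0 :=
    IsLocalMin.fderiv_eq_zero (Eventually.of_forall fun q => by rw [h0]; exact hFpos q)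
  have hcont : Continuous (fderiv ℝ F) := hF.continuous_fderiv one_ne_zero
  have hFsc : Continuous Fs := by
    rw [funext hFs]
    exact hcont.clm_apply continuous_const
  have hFtc : Continuous Ft := by
    rw [funext hFt]
    exact hcont.clm_apply continuous_const
  have hδ : 0 < ε / 2 := by linarith
  obtain ⟨a₁, ha₁, hs⟩ :=
    exists_forall_abs_le_of_tendsto_nhdsWithin (by rw [hFs, hcrit]; rfl) hFs0 hδ
  obtain ⟨a₂, ha₂, ht⟩ :=
    exists_forall_abs_le_of_tendsto_nhdsWithin (by rw [hFt, hcrit]; rfl) hFt0 hδ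
  obtain ⟨K₁, hK₁, hs'⟩ := exists_forall_abs_le_add_of_tendsto_comap_atTop hFsc hFsInf hδ
  obtain ⟨K₂, hK₂, ht'⟩ := exists_forall_abs_le_add_of_tendsto_comap_atTop hFtc hFtInf hδ
  have ha : 0 < min a₁ a₂ := lt_min ha₁ ha₂
  set a := min a₁ a₂ with ha_def
  refine ⟨(K₁ + K₂ + 1) * (2 * (a / 2) ^ (1 - r)), by positivity, fun p => ⟨hFpos p, ?_⟩⟩
  have hsq : ε / 2 * (|p.1| + |p.2|) * (|p.1| + |p.2|) ≤ ε * (p.1 ^ 2 + p.2 ^ 2) := by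
    rw [← sq_abs p.1, ← sq_abs p.2]
    nlinarith [mul_nonneg hε.le (sq_nonneg (|p.1| - |p.2|))]
  rcases lt_or_ge (|p.1| + |p.2|) a with hp | hp
  · have hle : F p ≤ ε / 2 * (|p.1| + |p.2|) * (|p.1| + |p.2|) := by
      refine le_mul_of_abs_partial_le hdiff h0 (fun q hq => ?_) (fun q hq => ?_)
      · rw [← hFs]
        exact (hs q (hq.trans_lt (hp.trans_le (min_le_left _ _)))).trans (by gcongr)
      · rw [← hFt]
        exact (ht q (hq.trans_lt (hp.trans_le (min_le_right _ _)))).trans (by gcongr)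
    have : 0 ≤ (K₁ + K₂ + 1) * (2 * (a / 2) ^ (1 - r)) * (|p.1| ^ r + |p.2| ^ r) := by
      positivity
    linarith
  · have hle : F p ≤ (ε / 2 * (|p.1| + |p.2|) + (K₁ + K₂ + 1)) * (|p.1| + |p.2|) := by
      refine le_mul_of_abs_partial_le hdiff h0 (fun q hq => ?_) (fun q hq => ?_)
      · rw [← hFs]
        exact (hs' q).trans (by gcongr; linarith)
      · rw [← hFt]
        exact (ht' q).trans (by gcongr; linarith)
    have hpow := mul_le_mul_of_nonneg_left (abs_add_abs_le_mul_rpow ha hr1.le hp)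
      (by positivity : 0 ≤ K₁ + K₂ + 1)
    linarith
end

section
/- (Ricceri-type three critical points theorem.) Let X be a separable and reflexive real Banach space. Let E₁ : X → ℝ be a coercive, sequentially weakly lower semicontinuous C¹ functional belonging to the class W_X, bounded on each bounded subset of X, and whose derivative E₁' : X → X* admits a continuous inverse. Let E₂ : X → ℝ be a C¹ functional with compact derivative. Assume E₁ has a strict local minimum u₀ with E₁(u₀) = E₂(u₀) = 0. Set τ = max{0, limsup_{‖u‖→∞} E₂(u)/E₁(u), limsup_{u→u₀} E₂(u)/E₁(u)} and χ = sup_{E₁(u)>0} E₂(u)/E₁(u), and assume τ < χ. Then for each compact interval [a,b] ⊂ (1/χ, 1/τ) (with the conventions 1/0 = ∞ and 1/∞ = 0) there exists κ > 0 with the following property: for every λ ∈ [a,b] and every C¹ functional E₃ : X → ℝ with compact derivative, there exists δ > 0 such that for each θ ∈ [0,δ], the equation E₁'(u) − λE₂'(u) − θE₃'(u) = 0 admits at least three solutions in X having norm less than κ. -/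
open Filter Topology Bornology

/-- A sequence in a normed space converges weakly to a point if it converges against
every continuous linear functional. -/
def WeaklyConvergesTo {X : Type*} [NormedAddCommGroup X] [NormedSpace ℝ X]
    (u : ℕ → X) (x : X) : Prop :=
  ∀ φ : X →L[ℝ] ℝ, Tendsto (fun n => φ (u n)) atTop (nhds (φ x))

/-- A `C¹` functional has compact derivative if its Fréchet derivative maps bounded
sets of `X` to relatively compact subsets of the dual `X →L[ℝ] ℝ`. -/
def HasCompactDerivative {X : Type*} [NormedAddCommGroup X] [NormedSpace ℝ X]
    (E : X → ℝ) : Prop :=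
  ∀ S : Set X, IsBounded S → IsCompact (closure ((fun x => fderiv ℝ E x) '' S))

/-- Ekeland's variational principle on a complete metric space. -/
theorem exists_ekeland_point {M : Type*} [MetricSpace M] [CompleteSpace M] {f : M → ℝ}
    (hf : LowerSemicontinuous f) {m : ℝ} (hm : ∀ x, m ≤ f x) {ε : ℝ} (hε : 0 < ε) (x₀ : M) :
    ∃ y, f y + ε * dist x₀ y ≤ f x₀ ∧ ∀ z, f y ≤ f z + ε * dist y z := by
  let S : M → Set M := fun y => {z | f z + ε * dist y z ≤ f y}
  have hself (y : M) : y ∈ S y := by simp [S]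
  have htrans {x y z : M} (hy : y ∈ S x) (hz : z ∈ S y) : z ∈ S x := by
    have := mul_le_mul_of_nonneg_left (dist_triangle x y z) hε.le
    simp only [S, Set.mem_ofPred_eq] at *
    linarith
  have hclosed (y : M) : IsClosed (S y) := by
    have hlsc : LowerSemicontinuous fun z => f z + ε * dist y z :=
      hf.add (Continuous.lowerSemicontinuous (by fun_prop))
    exact hlsc.isClosed_preimage (f y)
  have hbdd (y : M) : BddBelow (f '' S y) := ⟨m, by rintro _ ⟨z, -, rfl⟩; exact hm z⟩
  have hstep (n : ℕ) (y : M) : ∃ z ∈ S y, f z < sInf (f '' S y) + 1 / ((n : ℝ) + 1) := by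
    obtain ⟨_, ⟨z, hz, rfl⟩, hlt⟩ := Real.lt_sInf_add_pos (s := f '' S y) ⟨_, y, hself y, rfl⟩
      (ε := 1 / ((n : ℝ) + 1)) (by positivity)
    exact ⟨z, hz, hlt⟩
  choose g hgS hglt using hstep
  let u : ℕ → M := fun n => Nat.rec x₀ g n
  have hu_succ (n : ℕ) : u (n + 1) ∈ S (u n) := hgS n (u n)
  have hu_mem {n k : ℕ} (hnk : n ≤ k) : u k ∈ S (u n) := by
    induction k, hnk using Nat.le_induction with
    | base => exact hself _
    | succ k _ ih => exact htrans ih (hu_succ k)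
  have hanti : Antitone fun n => f (u n) := fun n k hnk => by
    have h : f (u k) + ε * dist (u n) (u k) ≤ f (u n) := hu_mem hnk
    have := mul_nonneg hε.le (dist_nonneg (x := u n) (y := u k))
    change f (u k) ≤ f (u n)
    linarith
  have hbd : BddBelow (Set.range fun n => f (u n)) := ⟨m, by rintro _ ⟨n, rfl⟩; exact hm _⟩
  have hlim := tendsto_atTop_ciInf hanti hbd
  have hcauchy : CauchySeq u := by
    refine cauchySeq_of_le_tendsto_0' (fun n => (f (u n) - ⨅ n, f (u n)) / ε) (fun n k hnk => ?_) ?_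
    · have h : f (u k) + ε * dist (u n) (u k) ≤ f (u n) := hu_mem hnk
      have := ciInf_le hbd k
      rw [le_div_iff₀ hε]
      linarith
    · simpa using (hlim.sub_const (⨅ n, f (u n))).div_const ε
  obtain ⟨y, hy⟩ := cauchySeq_tendsto_of_complete hcauchy
  have hyS (n : ℕ) : y ∈ S (u n) :=
    (hclosed _).mem_of_tendsto hy (eventually_atTop.2 ⟨n, fun k hk => hu_mem hk⟩)
  refine ⟨y, hyS 0, fun z => ?_⟩
  by_contra! hz
  have hzS (n : ℕ) : z ∈ S (u n) := htrans (hyS n) hz.le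
  have hle : f y ≤ f z := by
    have h1 : Tendsto (fun n : ℕ => f z + 1 / ((n : ℝ) + 1)) atTop (𝓝 (f z + 0)) :=
      tendsto_one_div_add_atTop_nhds_zero_nat.const_add _
    rw [add_zero] at h1
    refine ge_of_tendsto' h1 fun n => ?_
    have h2 : f y + ε * dist (u (n + 1)) y ≤ f (u (n + 1)) := hyS (n + 1)
    have h3 : f (u (n + 1)) < sInf (f '' S (u n)) + 1 / ((n : ℝ) + 1) := hglt n (u n)
    have h4 := csInf_le (hbdd (u n)) ⟨z, hzS n, rfl⟩
    have := mul_nonneg hε.le (dist_nonneg (x := u (n + 1)) (y := y))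
    linarith
  have := mul_nonneg hε.le (dist_nonneg (x := y) (y := z))
  linarith

section Slope

variable {X : Type*} [NormedAddCommGroup X] [NormedSpace ℝ X]

theorem norm_fderiv_le_of_eventually_le {f : X → ℝ} {y : X} {ε : ℝ} (hε : 0 ≤ ε)
    (hf : DifferentiableAt ℝ f y) (hmin : ∀ᶠ z in 𝓝 y, f y ≤ f z + ε * dist y z) :
    ‖fderiv ℝ f y‖ ≤ ε := by
  refine le_of_forall_pos_le_add fun η hη => ?_
  have hlo := hf.hasFDerivAt.isLittleO.def hη
  have hev : ∀ᶠ h in 𝓝 (0 : X), -(fderiv ℝ f y h) ≤ (ε + η) * ‖h‖ := by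
    have ht : Tendsto (fun h : X => y + h) (𝓝 0) (𝓝 y) := by
      simpa using (continuous_const.add continuous_id).tendsto (0 : X) (f := fun h : X => y + h)
    filter_upwards [ht.eventually hlo, ht.eventually hmin] with h h1 h2
    simp only [add_sub_cancel_left, dist_self_add_right] at h1 h2
    have := (abs_le.1 h1).2
    linarith
  refine ContinuousLinearMap.opNorm_le_of_nhds_zero (by positivity) ?_
  have hneg : Tendsto (fun h : X => -h) (𝓝 0) (𝓝 0) := by
    simpa using (continuous_neg (G := X)).tendsto 0
  filter_upwards [hev, hneg.eventually hev] with h h1 h2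
  rw [map_neg, norm_neg, neg_neg] at h2
  rw [Real.norm_eq_abs, abs_le]
  constructor <;> linarith

variable [CompleteSpace X]

theorem exists_small_slope {f : X → ℝ} (hf : Differentiable ℝ f) {S : Set X} (hS : IsClosed S)
    {m : ℝ} (hm : ∀ x ∈ S, m ≤ f x) {ε : ℝ} (hε : 0 < ε) {x₀ : X} (hx₀ : x₀ ∈ S) :
    ∃ y ∈ S, f y + ε * dist x₀ y ≤ f x₀ ∧ (y ∈ interior S → ‖fderiv ℝ f y‖ ≤ ε) := by
  have := hS.completeSpace_coe
  obtain ⟨y, hy, hmin⟩ := exists_ekeland_point (M := S) (f := fun x => f x)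
    (hf.continuous.comp continuous_subtype_val).lowerSemicontinuous (fun x => hm x x.2) hε ⟨x₀, hx₀⟩
  refine ⟨y, y.2, hy, fun hint => norm_fderiv_le_of_eventually_le hε.le (hf y) ?_⟩
  filter_upwards [mem_interior_iff_mem_nhds.1 hint] with z hz
  exact hmin ⟨z, hz⟩

/-- The Palais–Smale condition for `f` at levels bounded above. -/
def PalaisSmaleBelow {X : Type*} [NormedAddCommGroup X] [NormedSpace ℝ X] (f : X → ℝ) : Prop :=
  ∀ u : ℕ → X, (∃ C, ∀ n, f (u n) ≤ C) → Tendsto (fun n => fderiv ℝ f (u n)) atTop (𝓝 0) →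
    ∃ (v : X) (φ : ℕ → ℕ), StrictMono φ ∧ Tendsto (fun n => u (φ n)) atTop (𝓝 v)

theorem PalaisSmaleBelow.exists_critical {X : Type*} [NormedAddCommGroup X] [NormedSpace ℝ X]
    {f : X → ℝ} (hPS : PalaisSmaleBelow f) (hf : ContDiff ℝ 1 f) {S : Set X} (hS : IsClosed S)
    {C : ℝ} (hSC : ∀ x ∈ S, f x ≤ C)
    (h : ∀ ε > 0, ∃ x ∈ S, ‖fderiv ℝ f x‖ ≤ ε) : ∃ v ∈ S, fderiv ℝ f v = 0 := by
  choose! x hxS hx using h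
  have hpos (n : ℕ) : (0 : ℝ) < 1 / ((n : ℝ) + 1) := by positivity
  have hlim : Tendsto (fun n : ℕ => fderiv ℝ f (x (1 / ((n : ℝ) + 1)))) atTop (𝓝 0) :=
    squeeze_zero_norm (fun n => hx _ (hpos n)) tendsto_one_div_add_atTop_nhds_zero_nat
  obtain ⟨v, φ, hφ, hv⟩ := hPS _ ⟨C, fun n => hSC _ (hxS _ (hpos n))⟩ hlim
  refine ⟨v, hS.mem_of_tendsto hv (Eventually.of_forall fun n => hxS _ (hpos _)), ?_⟩
  exact tendsto_nhds_unique (((hf.continuous_fderiv one_ne_zero).tendsto v).comp hv)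
    (hlim.comp hφ.tendsto_atTop)

theorem PalaisSmaleBelow.exists_critical_le {f : X → ℝ} (hPS : PalaisSmaleBelow f)
    (hf : ContDiff ℝ 1 f) {S : Set X} (hS : IsClosed S) {m : ℝ} (hm : ∀ x ∈ S, m ≤ f x)
    {x₀ : X} (hx₀ : x₀ ∈ S) (hint : ∀ y ∈ S, f y ≤ f x₀ → y ∈ interior S) :
    ∃ v ∈ S, f v ≤ f x₀ ∧ fderiv ℝ f v = 0 := by
  have hc := hf.continuous
  obtain ⟨v, hv, hv'⟩ := hPS.exists_critical hf (S := S ∩ {x | f x ≤ f x₀})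
    (hS.inter (isClosed_le hc continuous_const)) (fun x hx => hx.2) fun ε hε => by
      obtain ⟨y, hyS, hy, hy'⟩ :=
        exists_small_slope (hf.differentiable one_ne_zero) hS hm hε hx₀
      have := mul_nonneg hε.le (dist_nonneg (x := x₀) (y := y))
      have hle : f y ≤ f x₀ := by linarith
      exact ⟨y, ⟨hyS, hle⟩, hy' (hint y hyS hle)⟩
  exact ⟨v, hv.1, hv.2, hv'⟩

/-- A strict local minimum of a functional satisfying the Palais–Smale condition is surrounded
by a sphere on which the functional stays uniformly above the minimum. -/
theorem PalaisSmaleBelow.exists_sphere_pos {f : X → ℝ} (hPS : PalaisSmaleBelow f)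
    (hf : ContDiff ℝ 1 f) {x₀ : X} {r : ℝ} (hr : 0 < r)
    (hpos : ∀ x, x ≠ x₀ → dist x x₀ ≤ 3 * r → 0 < f x) :
    ∃ η > 0, ∀ x, dist x x₀ = 2 * r → η ≤ f x := by
  by_contra! hcon
  have hc := hf.continuous
  let S : Set X := {x | r ≤ dist x x₀} ∩ {x | dist x x₀ ≤ 3 * r}
  have hSc : IsClosed S := (isClosed_le continuous_const (by fun_prop)).inter
    (isClosed_le (by fun_prop) continuous_const)
  have hS0 : ∀ x ∈ S, 0 < f x := fun x hx =>
    hpos x (dist_pos.1 (hr.trans_le hx.1)) hx.2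
  have hpt (n : ℕ) : ∃ y ∈ S, f y ≤ (r / (n + 2)) ^ 2 ∧ ‖fderiv ℝ f y‖ ≤ r / (n + 2) := by
    have hε : 0 < r / ((n : ℝ) + 2) := by positivity
    obtain ⟨x, hx, hfx⟩ := hcon _ (pow_pos hε 2)
    obtain ⟨y, hyS, hy, hy'⟩ := exists_small_slope (hf.differentiable one_ne_zero) hSc
      (fun x hx => (hS0 x hx).le) hε (x₀ := x)
      ⟨show r ≤ dist x x₀ by linarith, show dist x x₀ ≤ 3 * r by linarith⟩
    have hd0 := mul_nonneg hε.le (dist_nonneg (x := x) (y := y))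
    have hd : dist x y < r / ((n : ℝ) + 2) := by
      have := hS0 y hyS
      refine lt_of_mul_lt_mul_left (a := r / ((n : ℝ) + 2)) ?_ hε.le
      nlinarith
    have hεr : r / ((n : ℝ) + 2) ≤ r := div_le_self hr.le (by have := n.cast_nonneg (α := ℝ); linarith)
    refine ⟨y, hyS, by linarith, hy' ?_⟩
    refine interior_maximal (s := S) (t := {x | r < dist x x₀} ∩ {x | dist x x₀ < 3 * r})
      (Set.inter_subset_inter (fun _ => le_of_lt (α := ℝ)) fun _ => le_of_lt (α := ℝ))
      ((isOpen_lt continuous_const (by fun_prop)).inter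
        (isOpen_lt (by fun_prop) continuous_const)) ?_
    have h1 := dist_triangle x y x₀
    have h2 := dist_triangle_left y x₀ x
    exact ⟨show r < dist y x₀ by linarith, show dist y x₀ < 3 * r by linarith⟩
  choose y hyS hy hy' using hpt
  have hlim0 : Tendsto (fun n : ℕ => r / ((n : ℝ) + 2)) atTop (𝓝 0) :=
    tendsto_const_nhds.div_atTop (tendsto_atTop_add_const_right _ _ tendsto_natCast_atTop_atTop)
  have hlim2 : Tendsto (fun n : ℕ => (r / ((n : ℝ) + 2)) ^ 2) atTop (𝓝 0) := by
    simpa using hlim0.pow 2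
  obtain ⟨C, hC⟩ := hlim2.bddAbove_range
  obtain ⟨v, φ, hφ, hv⟩ := hPS y ⟨C, fun n => (hy n).trans (hC ⟨n, rfl⟩)⟩
    (squeeze_zero_norm hy' hlim0)
  have hvS := hSc.mem_of_tendsto hv (Eventually.of_forall fun n => hyS _)
  have hle := le_of_tendsto_of_tendsto' ((hc.tendsto v).comp hv)
    (hlim2.comp hφ.tendsto_atTop) fun n => hy (φ n)
  exact (hS0 v hvS).not_ge hle

end Slope

section MountainPass

variable {X : Type*} [NormedAddCommGroup X] [NormedSpace ℝ X]

theorem ContinuousLinearMap.exists_norm_le_one_apply_lt_neg {A : X →L[ℝ] ℝ} {ε : ℝ}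
    (h : ε < ‖A‖) : ∃ w : X, ‖w‖ ≤ 1 ∧ A w < -ε := by
  obtain ⟨x, hx, hlt⟩ := A.exists_lt_apply_of_lt_opNorm h
  rcases lt_abs.1 hlt with h1 | h1
  · exact ⟨-x, by rw [norm_neg]; exact hx.le, by rw [map_neg]; linarith⟩
  · exact ⟨x, hx.le, by linarith⟩

/-- A path all of whose highest points have slope larger than `ε` can be lowered, keeping its
endpoints fixed, by more than `ε` times the displacement. -/
theorem exists_lower_path {f : X → ℝ} (hf : ContDiff ℝ 1 f) (γ : C(unitInterval, X)) {c ε : ℝ}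
    (hc : ∀ t, f (γ t) ≤ c) (h0 : f (γ 0) < c) (h1 : f (γ 1) < c)
    (hslope : ∀ t, f (γ t) = c → ε < ‖fderiv ℝ f (γ t)‖) :
    ∃ h > 0, ∃ γ' : C(unitInterval, X), γ' 0 = γ 0 ∧ γ' 1 = γ 1 ∧
      (∀ t, dist (γ t) (γ' t) ≤ h) ∧ ∀ t, f (γ' t) < c - ε * h := by
  have hfc := hf.continuous
  have hfc' := hf.continuous_fderiv one_ne_zero
  obtain ⟨v, hv⟩ := exists_continuous_forall_mem_convex_of_local_const
    (t := fun s : unitInterval => Metric.closedBall (0 : X) 1 ∩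
      ({w | f (γ s) = c → fderiv ℝ f (γ s) w < -ε} ∩ {w | s = 0 ∨ s = 1 → w = 0})) (fun s => by
      refine (convex_closedBall 0 1).inter (Convex.inter ?_ ?_)
      · by_cases hs : f (γ s) = c
        · simpa [hs] using convex_halfSpace_lt (fderiv ℝ f (γ s)).toLinearMap.isLinear (-ε)
        · simpa [hs] using convex_univ
      · by_cases hs : s = 0 ∨ s = 1
        · simpa only [hs, true_imp_iff, Set.ofPred_eq_eq_singleton] using convex_singleton (0 : X)
        · simpa only [hs, false_imp_iff, Set.ofPred_true] using convex_univ) fun s => by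
      by_cases hs : f (γ s) = c
      · obtain ⟨w, hw, hw'⟩ :=
          ContinuousLinearMap.exists_norm_le_one_apply_lt_neg (hslope s hs)
        have hs0 : s ≠ 0 := by rintro rfl; exact h0.ne hs
        have hs1 : s ≠ 1 := by rintro rfl; exact h1.ne hs
        have hcont : Continuous fun y => fderiv ℝ f (γ y) w :=
          (hfc'.comp γ.continuous).clm_apply continuous_const
        refine ⟨w, ?_⟩
        filter_upwards [hcont.continuousAt.eventually_lt_const hw', eventually_ne_nhds hs0,
          eventually_ne_nhds hs1] with y hy hy0 hy1
        exact ⟨by simpa using hw, fun _ => hy, fun h => by tauto⟩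
      · refine ⟨0, ?_⟩
        have hcont : Continuous fun y => f (γ y) := hfc.comp γ.continuous
        filter_upwards [hcont.continuousAt.eventually_ne hs] with y hy
        exact ⟨by simp, fun h => absurd h hy, fun _ => rfl⟩
  have hvn (s) : ‖v s‖ ≤ 1 := by simpa using (hv s).1
  have hloc : ∀ s ∈ (Set.univ : Set unitInterval), ∀ᶠ z : ℝ × unitInterval in 𝓝 (0, s),
      0 < z.1 → f (γ z.2 + z.1 • v z.2) < c - ε * z.1 := by
    intro s _
    have hmove : Continuous fun z : ℝ × unitInterval => γ z.2 + z.1 • v z.2 := by fun_prop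
    rcases (hc s).lt_or_eq with hs | hs
    · have hcont : Continuous fun z : ℝ × unitInterval => f (γ z.2 + z.1 • v z.2) + ε * z.1 :=
        (hfc.comp hmove).add (by fun_prop)
      filter_upwards [(hcont.tendsto (0, s)).eventually_lt_const (u := c)
        (by simpa using hs)] with z hz _
      linarith
    · have hA : fderiv ℝ f (γ s) (v s) < -ε := (hv s).2.1 hs
      obtain ⟨b, hb1, hb2⟩ := exists_between hA
      have hη : 0 < -ε - b := by linarith
      have hstrict := (hf.contDiffAt.hasStrictFDerivAt (x := γ s) one_ne_zero).isLittleO.def hη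
      have hpair : Tendsto (fun z : ℝ × unitInterval => (γ z.2 + z.1 • v z.2, γ z.2))
          (𝓝 (0, s)) (𝓝 (γ s, γ s)) := by
        have h : Continuous fun z : ℝ × unitInterval => (γ z.2 + z.1 • v z.2, γ z.2) := by
          fun_prop
        simpa using h.tendsto (0, s)
      have hcont : Continuous fun z : ℝ × unitInterval => fderiv ℝ f (γ s) (v z.2) := by fun_prop
      filter_upwards [hpair.eventually hstrict,
        (hcont.tendsto (0, s)).eventually_lt_const hb1] with z hz1 hz2 hz
      simp only [add_sub_cancel_left, map_smul, smul_eq_mul, norm_smul, Real.norm_eq_abs,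
        abs_of_pos hz] at hz1
      have h3 := (abs_le.1 hz1).2
      have h4 : (-ε - b) * (z.1 * ‖v z.2‖) ≤ (-ε - b) * (z.1 * 1) := by
        gcongr
        exact hvn _
      have h5 := mul_lt_mul_of_pos_left hz2 hz
      have h6 := hc z.2
      nlinarith
  have hev := isCompact_univ.eventually_forall_of_forall_eventually
    (P := fun (h : ℝ) (s : unitInterval) => 0 < h → f (γ s + h • v s) < c - ε * h) hloc
  obtain ⟨h, hh, hpos⟩ := ((hev.filter_mono nhdsWithin_le_nhds).and
    (self_mem_nhdsWithin (s := Set.Ioi (0 : ℝ)))).exists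
  refine ⟨h, hpos, γ + h • v, ?_, ?_, fun t => ?_, fun t => hh t trivial hpos⟩
  · have : v 0 = 0 := (hv 0).2.2 (Or.inl rfl)
    simp [this]
  · have : v 1 = 0 := (hv 1).2.2 (Or.inr rfl)
    simp [this]
  · have : 0 < h := hpos
    simp only [ContinuousMap.add_apply, ContinuousMap.smul_apply, dist_self_add_right, norm_smul,
      Real.norm_eq_abs, abs_of_pos this]
    exact mul_le_of_le_one_right this.le (hvn t)

theorem PalaisSmaleBelow.exists_mountain_pass [CompleteSpace X] {f : X → ℝ}
    (hPS : PalaisSmaleBelow f) (hf : ContDiff ℝ 1 f) {p q : X} {R β L : ℝ} (hR : 0 ≤ R)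
    (hRq : R ≤ dist q p) (hβ : ∀ x, dist x p = R → β ≤ f x) (hp : f p < β) (hq : f q < β)
    (hL : ∀ x ∈ segment ℝ p q, f x ≤ L) :
    ∃ v, fderiv ℝ f v = 0 ∧ β ≤ f v ∧ f v ≤ L := by
  have hfc := hf.continuous
  suffices h : ∃ v ∈ {x | β ≤ f x} ∩ {x | f x ≤ L}, fderiv ℝ f v = 0 by
    obtain ⟨v, hv, hv'⟩ := h
    exact ⟨v, hv', hv.1, hv.2⟩
  refine hPS.exists_critical hf ((isClosed_le continuous_const hfc).inter
    (isClosed_le hfc continuous_const)) (fun x hx => hx.2) fun ε hε => ?_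
  let Γ : Set C(unitInterval, X) := {γ | γ 0 = p} ∩ {γ | γ 1 = q}
  have hΓ : IsClosed Γ :=
    (isClosed_eq (continuous_eval_const 0) continuous_const).inter
      (isClosed_eq (continuous_eval_const 1) continuous_const)
  have := hΓ.completeSpace_coe
  have hbdd (γ : C(unitInterval, X)) : BddAbove (Set.range fun t => f (γ t)) :=
    (isCompact_range (hfc.comp γ.continuous)).bddAbove
  let Φ : Γ → ℝ := fun γ => ⨆ t, f (γ.1 t)
  have hΦ : LowerSemicontinuous Φ := lowerSemicontinuous_ciSup (fun γ => hbdd γ.1) fun t =>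
    (hfc.comp ((continuous_eval_const t).comp
      continuous_subtype_val)).lowerSemicontinuous
  have hΦβ (γ : Γ) : β ≤ Φ γ := by
    obtain ⟨t, ht⟩ := mem_range_of_exists_le_of_exists_ge (c := R)
      (f := fun t => dist (γ.1 t) p) (by fun_prop)
      ⟨0, by have : γ.1 0 = p := γ.2.1; simpa [this] using hR⟩
      ⟨1, by have : γ.1 1 = q := γ.2.2; simpa [this] using hRq⟩
    exact (hβ _ ht).trans (le_ciSup (hbdd γ.1) t)
  let γ₀ : Γ := ⟨⟨fun t => AffineMap.lineMap p q (t : ℝ), by fun_prop⟩,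
    by simp [Γ]⟩
  obtain ⟨γ, hγ, hmin⟩ := exists_ekeland_point hΦ hΦβ hε γ₀
  have hγ₀ : Φ γ₀ ≤ L := ciSup_le fun t => hL _ (by
    rw [segment_eq_image_lineMap]
    exact ⟨t, t.2, rfl⟩)
  have hγL : Φ γ ≤ L := by
    have := mul_nonneg hε.le (dist_nonneg (x := γ₀) (y := γ))
    linarith
  by_contra! hcon
  have hβγ := hΦβ γ
  have hγ0 : γ.1 0 = p := γ.2.1
  have hγ1 : γ.1 1 = q := γ.2.2
  obtain ⟨h, hh, γ', h0, h1, hdist, hlow⟩ := exists_lower_path hf γ.1 (c := Φ γ)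
    (fun t => le_ciSup (hbdd γ.1) t) (by rw [hγ0]; linarith) (by rw [hγ1]; linarith)
    fun t ht => hcon _ ⟨show β ≤ f (γ.1 t) by linarith, show f (γ.1 t) ≤ L by linarith⟩
  have hm := hmin ⟨γ', h0.trans hγ0, h1.trans hγ1⟩
  have hd : dist γ ⟨γ', h0.trans hγ0, h1.trans hγ1⟩ ≤ h :=
    (ContinuousMap.dist_le hh.le).2 hdist
  obtain ⟨t, -, ht⟩ := isCompact_univ.exists_isMaxOn Set.univ_nonempty
    (hfc.comp γ'.continuous).continuousOn
  have hle : Φ ⟨γ', h0.trans hγ0, h1.trans hγ1⟩ ≤ f (γ' t) := ciSup_le fun s => ht (Set.mem_univ s)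
  have h2 := hlow t
  have h3 := mul_le_mul_of_nonneg_left hd hε.le
  linarith

end MountainPass

section CompactMaps

/-- A map sending every bounded sequence to a sequence with a convergent subsequence. -/
def SeqCompactMap {X Y : Type*} [NormedAddCommGroup X] [TopologicalSpace Y] (K : X → Y) : Prop :=
  ∀ u : ℕ → X, IsBounded (Set.range u) →
    ∃ (y : Y) (φ : ℕ → ℕ), StrictMono φ ∧ Tendsto (fun n => K (u (φ n))) atTop (𝓝 y)

variable {X : Type*} [NormedAddCommGroup X]

theorem SeqCompactMap.of_isCompact {Y : Type*} [TopologicalSpace Y] [FirstCountableTopology Y]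
    {K : X → Y} {S : Set Y} (hS : IsCompact S) (hK : ∀ x, K x ∈ S) : SeqCompactMap K :=
  fun u _ => by
    obtain ⟨y, -, φ, hφ, hy⟩ := hS.tendsto_subseq fun n => hK (u n)
    exact ⟨y, φ, hφ, hy⟩

theorem SeqCompactMap.prodMk {Y Z : Type*} [TopologicalSpace Y] [TopologicalSpace Z] {K : X → Y}
    {K' : X → Z} (hK : SeqCompactMap K) (hK' : SeqCompactMap K') :
    SeqCompactMap fun x => (K x, K' x) := fun u hu => by
  obtain ⟨y, φ, hφ, hy⟩ := hK u hu
  obtain ⟨z, ψ, hψ, hz⟩ := hK' (u ∘ φ) (hu.subset (Set.range_comp_subset_range φ u))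
  exact ⟨(y, z), φ ∘ ψ, hφ.comp hψ, (hy.comp hψ.tendsto_atTop).prodMk_nhds hz⟩

theorem SeqCompactMap.continuous_comp {Y Z : Type*} [TopologicalSpace Y] [TopologicalSpace Z]
    {K : X → Y} (hK : SeqCompactMap K) {F : Y → Z} (hF : Continuous F) :
    SeqCompactMap fun x => F (K x) := fun u hu => by
  obtain ⟨y, φ, hφ, hy⟩ := hK u hu
  exact ⟨F y, φ, hφ, (hF.tendsto y).comp hy⟩

variable [NormedSpace ℝ X]

theorem HasCompactDerivative.seqCompactMap {E : X → ℝ} (hE : HasCompactDerivative E) :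
    SeqCompactMap (fderiv ℝ E) := fun u hu => by
  obtain ⟨y, -, φ, hφ, hy⟩ := (hE _ hu).tendsto_subseq
    (x := fun n => fderiv ℝ E (u n)) fun n => subset_closure ⟨u n, ⟨n, rfl⟩, rfl⟩
  exact ⟨y, φ, hφ, hy⟩

/-- A functional whose sublevel sets are bounded satisfies the Palais–Smale condition if its
derivative is a compact perturbation of a map with a continuous left inverse. -/
theorem palaisSmaleBelow_of_fderiv_eq_sub {f : X → ℝ} {A K : X → X →L[ℝ] ℝ}
    {T : (X →L[ℝ] ℝ) → X} (hT : Continuous T) (hTA : Function.LeftInverse T A)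
    (hK : SeqCompactMap K) (hf : ∀ u, fderiv ℝ f u = A u - K u)
    (hb : ∀ C, IsBounded {u | f u ≤ C}) : PalaisSmaleBelow f := by
  rintro u ⟨C, hC⟩ hu
  obtain ⟨y, φ, hφ, hy⟩ := hK u ((hb C).subset (by rintro _ ⟨n, rfl⟩; exact hC n))
  have hA : Tendsto (fun n => A (u (φ n))) atTop (𝓝 (0 + y)) :=
    ((hu.comp hφ.tendsto_atTop).add hy).congr fun n => by simp [hf]
  exact ⟨T (0 + y), φ, hφ, ((hT.tendsto _).comp hA).congr fun n => hTA _⟩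

theorem HasCompactDerivative.exists_abs_le {E : X → ℝ} (hE : HasCompactDerivative E)
    (hd : Differentiable ℝ E) (R : ℝ) : ∃ C, 0 ≤ C ∧ ∀ u, ‖u‖ ≤ R → |E u| ≤ C := by
  obtain ⟨B, hB⟩ := (hE _ (Metric.isBounded_closedBall (x := (0 : X)) (r := R))).isBounded
    |>.exists_norm_le
  refine ⟨|E 0| + |B| * |R|, by positivity, fun u hu => ?_⟩
  have h0 : (0 : X) ∈ Metric.closedBall (0 : X) R := by
    simpa using (norm_nonneg u).trans hu
  have hu' : u ∈ Metric.closedBall (0 : X) R := by simpa using hu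
  have h := (convex_closedBall (0 : X) R).norm_image_sub_le_of_norm_fderiv_le (𝕜 := ℝ)
    (f := E) (C := |B|) (fun x _ => hd x)
    (fun x hx => (hB _ (subset_closure ⟨x, hx, rfl⟩)).trans (le_abs_self B)) h0 hu'
  rw [sub_zero, Real.norm_eq_abs] at h
  have h1 : |B| * ‖u‖ ≤ |B| * |R| := by
    gcongr
    exact hu.trans (le_abs_self R)
  have h2 := abs_sub_abs_le_abs_sub (E u) (E 0)
  linarith

/-- A bounded `C¹` truncation of the identity of `ℝ`. -/
theorem exists_bounded_truncation {K : ℝ} (hK : 0 < K) :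
    ∃ g : ℝ → ℝ, ContDiff ℝ 1 g ∧ (∃ C, 0 ≤ C ∧ ∀ t, |g t| ≤ C) ∧
      IsCompact (Set.range (deriv g)) ∧ ∀ t, |t| < K → deriv g t = 1 := by
  let b : ContDiffBump (0 : ℝ) := ⟨K, K + 1, hK, by linarith⟩
  have hg : ContDiff ℝ 1 fun t => t * b t := contDiff_id.mul b.contDiff
  have hs : HasCompactSupport fun t => t * b t := b.hasCompactSupport.mul_left
  refine ⟨fun t => t * b t, hg, ?_, hs.deriv.isCompact_range (hg.continuous_deriv le_rfl),
    fun t ht => ?_⟩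
  · obtain ⟨C, hC⟩ := (hs.isCompact_range hg.continuous).isBounded.exists_norm_le
    exact ⟨C, (norm_nonneg _).trans (hC _ ⟨0, rfl⟩), fun t => hC _ ⟨t, rfl⟩⟩
  · have heq : (fun t => t * b t) =ᶠ[𝓝 t] fun t => t := by
      filter_upwards [Metric.isOpen_ball.mem_nhds
        (show t ∈ Metric.ball (0 : ℝ) K by simpa using ht)] with s hs
      rw [b.one_of_mem_closedBall (Metric.ball_subset_closedBall hs), mul_one]
    rw [heq.deriv_eq, deriv_id'']

end CompactMaps

section ThreeCriticalPoints

variable {X : Type*} [NormedAddCommGroup X] [NormedSpace ℝ X] [CompleteSpace X]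

/-- Three critical points of a small perturbation `G` of a functional `J` which has a local
minimum `u₀` surrounded by a sphere of larger values and takes a smaller value elsewhere. -/
theorem exists_three_critical_points {J G : X → ℝ} (hG : ContDiff ℝ 1 G)
    (hPS : PalaisSmaleBelow G) {u₀ u₁ : X} {R η ε L m : ℝ} (hR : 0 < R)
    (hη : ∀ u, dist u u₀ = R → η ≤ J u) (hball : ∀ u, dist u u₀ ≤ R → 0 ≤ J u)
    (hu₀ : J u₀ = 0) (hL : ∀ u ∈ segment ℝ u₀ u₁, J u ≤ L) (hm : ∀ u, m ≤ G u)
    (hGJ : ∀ u, |G u - J u| ≤ ε) (hεη : 2 * ε < η) (hu₁ : J u₁ < -(2 * ε)) :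
    ∃ v₁ v₂ v₃ : X, v₁ ≠ v₂ ∧ v₁ ≠ v₃ ∧ v₂ ≠ v₃ ∧
      ∀ v ∈ ({v₁, v₂, v₃} : Set X), fderiv ℝ G v = 0 ∧ J v ≤ L + 2 * ε := by
  have hlo (u : X) : J u - ε ≤ G u := by have := (abs_le.1 (hGJ u)).1; linarith
  have hup (u : X) : G u ≤ J u + ε := by have := (abs_le.1 (hGJ u)).2; linarith
  have hε : 0 ≤ ε := (abs_nonneg _).trans (hGJ u₀)
  have hu₀' := hup u₀
  have hu₁' := hup u₁
  have hL₀ := hL _ (left_mem_segment ℝ u₀ u₁)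
  have hL₁ := hL _ (right_mem_segment ℝ u₀ u₁)
  have hd : R ≤ dist u₁ u₀ := by
    by_contra! h
    have := hball u₁ h.le
    linarith
  obtain ⟨v₁, hv₁, hle₁, hc₁⟩ := hPS.exists_critical_le hG
    (S := Metric.closedBall u₀ R) Metric.isClosed_closedBall (fun u _ => hm u)
    (Metric.mem_closedBall_self hR.le) fun y hy hyle => by
      refine Metric.ball_subset_interior_closedBall (Metric.mem_ball.2
        (lt_of_le_of_ne (Metric.mem_closedBall.1 hy) fun h => ?_))
      have := hη y h
      have := hlo y
      linarith
  obtain ⟨v₂, -, hle₂, hc₂⟩ := hPS.exists_critical_le hG isClosed_univ (fun u _ => hm u)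
    (Set.mem_univ u₁) fun y _ _ => by simp
  obtain ⟨v₃, hc₃, hge₃, hle₃⟩ := hPS.exists_mountain_pass hG (p := u₀) (q := u₁) (R := R)
    (β := η - ε) (L := L + ε) hR.le hd
    (fun x hx => by have := hη x hx; have := hlo x; linarith) (by linarith) (by linarith)
    fun x hx => by have := hL x hx; have := hup x; linarith
  have hb₁ := hball v₁ hv₁
  have h₁ := hlo v₁
  have h₂ := hlo v₂
  have h₃ := hlo v₃
  refine ⟨v₁, v₂, v₃, ?_, ?_, ?_, ?_⟩
  · rintro rfl; linarith
  · rintro rfl; linarith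
  · rintro rfl; linarith
  · rintro v (rfl | rfl | rfl)
    · exact ⟨hc₁, by linarith⟩
    · exact ⟨hc₂, by linarith⟩
    · exact ⟨hc₃, by linarith⟩

end ThreeCriticalPoints

/-- Ricceri-type three critical points theorem.
The interval condition `[a,b] ⊂ (1/χ, 1/τ)` (with the conventions `1/0 = ∞`, `1/∞ = 0`)
is encoded equivalently in `EReal` by `1 < λ·χ` and `λ·τ < 1` for every `λ ∈ [a,b]`. -/
theorem stmt_14
    (X : Type*) [NormedAddCommGroup X] [NormedSpace ℝ X] [CompleteSpace X]
    [TopologicalSpace.SeparableSpace X]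
    -- reflexivity: the canonical embedding into the double dual is surjective
    (hrefl : Function.Surjective (NormedSpace.inclusionInDoubleDual ℝ X))
    (E₁ E₂ : X → ℝ) (u₀ : X)
    (hE₁C1 : ContDiff ℝ 1 E₁)
    (hE₁coercive : Tendsto E₁ (comap norm atTop) atTop)
    (hE₁swlsc : ∀ (u : ℕ → X) (x : X), WeaklyConvergesTo u x →
      (E₁ x : EReal) ≤ liminf (fun n => ((E₁ (u n) : ℝ) : EReal)) atTop)
    (hE₁W : ∀ (u : ℕ → X) (x : X), WeaklyConvergesTo u x →
      liminf (fun n => ((E₁ (u n) : ℝ) : EReal)) atTop ≤ (E₁ x : EReal) →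
      ∃ φ : ℕ → ℕ, StrictMono φ ∧ Tendsto (fun n => u (φ n)) atTop (nhds x))
    (hE₁bdd : ∀ S : Set X, IsBounded S → IsBounded (E₁ '' S))
    (hE₁inv : ∃ T : (X →L[ℝ] ℝ) → X, Continuous T ∧
      Function.LeftInverse T (fun x => fderiv ℝ E₁ x) ∧
      Function.RightInverse T (fun x => fderiv ℝ E₁ x))
    (hE₂C1 : ContDiff ℝ 1 E₂)
    (hE₂cpt : HasCompactDerivative E₂)
    (hu₀min : ∃ U ∈ nhds u₀, ∀ u ∈ U, u ≠ u₀ → E₁ u₀ < E₁ u)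
    (hE₁u₀ : E₁ u₀ = 0) (hE₂u₀ : E₂ u₀ = 0)
    (τ χ : EReal)
    (hτ : τ = max 0 (max
      (limsup (fun u : X => ((E₂ u / E₁ u : ℝ) : EReal)) (comap norm atTop))
      (limsup (fun u : X => ((E₂ u / E₁ u : ℝ) : EReal)) (nhdsWithin u₀ {u₀}ᶜ))))
    (hχ : χ = ⨆ u ∈ {u : X | 0 < E₁ u}, ((E₂ u / E₁ u : ℝ) : EReal))
    (hτχ : τ < χ) :
    ∀ a b : ℝ, a ≤ b →
      (∀ lam ∈ Set.Icc a b, 1 < (lam : EReal) * χ ∧ (lam : EReal) * τ < 1) →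
      ∃ κ : ℝ, 0 < κ ∧ ∀ lam ∈ Set.Icc a b, ∀ E₃ : X → ℝ,
        ContDiff ℝ 1 E₃ → HasCompactDerivative E₃ →
        ∃ δ : ℝ, 0 < δ ∧ ∀ θ ∈ Set.Icc (0 : ℝ) δ,
          ∃ u₁ u₂ u₃ : X, u₁ ≠ u₂ ∧ u₁ ≠ u₃ ∧ u₂ ≠ u₃ ∧
            ∀ u ∈ ({u₁, u₂, u₃} : Set X),
              fderiv ℝ E₁ u - lam • fderiv ℝ E₂ u - θ • fderiv ℝ E₃ u = 0 ∧ ‖u‖ < κ := by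
  intro a b hab hlam
  have hτ0 : 0 ≤ τ := hτ ▸ le_max_left _ _
  have hχ0 : 0 < χ := hτ0.trans_lt hτχ
  have ha : 0 < a := by
    by_contra! h
    have h1 := (hlam a ⟨le_rfl, hab⟩).1
    have h2 : (a : EReal) * χ ≤ 0 * χ :=
      mul_le_mul_of_nonneg_right (EReal.coe_nonpos.2 h) hχ0.le
    rw [zero_mul] at h2
    exact (h1.trans_le h2).not_ge zero_le_one
  have hb : 0 < b := ha.trans_le hab
  obtain ⟨q, hq0, hτq, hbq⟩ : ∃ q : ℝ, 0 ≤ q ∧ τ < q ∧ b * q < 1 := by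
    lift τ to ℝ using ⟨hτχ.ne_top, (EReal.bot_lt_zero.trans_le hτ0).ne'⟩
    have h1 : b * τ < 1 := by exact_mod_cast (hlam b ⟨hab, le_rfl⟩).2
    have h2 : τ < 1 / b := by rw [lt_div_iff₀ hb]; linarith
    obtain ⟨q, hq1, hq2⟩ := exists_between h2
    have h3 : 0 ≤ τ := by exact_mod_cast hτ0
    refine ⟨q, h3.trans hq1.le, by exact_mod_cast hq1, ?_⟩
    rw [lt_div_iff₀ hb] at hq2
    linarith
  have hkey : ∀ lam ∈ Set.Icc a b, ∀ u, 0 < E₁ u → E₂ u / E₁ u < q →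
      (1 - b * q) * E₁ u ≤ E₁ u - lam * E₂ u := by
    intro lam hl u hu huq
    rw [div_lt_iff₀ hu] at huq
    have h1 : lam * E₂ u ≤ lam * (q * E₁ u) :=
      mul_le_mul_of_nonneg_left huq.le (ha.le.trans hl.1)
    have h2 : lam * (q * E₁ u) ≤ b * (q * E₁ u) :=
      mul_le_mul_of_nonneg_right hl.2 (mul_nonneg hq0 hu.le)
    linarith
  have hc0 : 0 < 1 - b * q := by linarith
  have hinf : ∀ᶠ u in comap norm atTop, E₂ u / E₁ u < q := by
    have h : limsup (fun u : X => ((E₂ u / E₁ u : ℝ) : EReal)) (comap norm atTop) < q :=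
      (((le_max_left _ _).trans (le_max_right _ _)).trans hτ.ge).trans_lt hτq
    filter_upwards [eventually_lt_of_limsup_lt h] with u hu
    exact_mod_cast hu
  have hnear : ∀ᶠ u in 𝓝[≠] u₀, E₂ u / E₁ u < q := by
    have h : limsup (fun u : X => ((E₂ u / E₁ u : ℝ) : EReal)) (𝓝[≠] u₀) < q :=
      (((le_max_right _ _).trans (le_max_right _ _)).trans hτ.ge).trans_lt hτq
    filter_upwards [eventually_lt_of_limsup_lt h] with u hu
    exact_mod_cast hu
  have hcoer (C : ℝ) : ∃ R : ℝ, ∀ lam ∈ Set.Icc a b, ∀ u, E₁ u - lam * E₂ u ≤ C → ‖u‖ < R := by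
    have hev := (hE₁coercive.eventually_gt_atTop (max 0 (C / (1 - b * q)))).and hinf
    obtain ⟨R, -, hR⟩ := (atTop_basis.comap (norm : X → ℝ)).eventually_iff.1 hev
    refine ⟨R, fun lam hl u hu => ?_⟩
    by_contra! h
    obtain ⟨h1, h2⟩ := hR (show u ∈ norm ⁻¹' Set.Ici R from h)
    have h3 := hkey lam hl u ((le_max_left _ _).trans_lt h1) h2
    have h4 := (le_max_right _ _).trans_lt h1
    rw [div_lt_iff₀ hc0] at h4
    linarith
  obtain ⟨R₀, hR₀⟩ := hcoer 0
  set R₁ := max R₀ ‖u₀‖ with hR₁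
  obtain ⟨K₁, hK₁⟩ : ∃ K₁, ∀ u, ‖u‖ ≤ R₁ → |E₁ u| ≤ K₁ := by
    obtain ⟨C, hC⟩ := (hE₁bdd _ (Metric.isBounded_closedBall (x := (0 : X)) (r := R₁))).exists_norm_le
    exact ⟨C, fun u hu => hC _ ⟨u, by simpa using hu, rfl⟩⟩
  obtain ⟨K₂, -, hK₂⟩ := hE₂cpt.exists_abs_le (hE₂C1.differentiable one_ne_zero) R₁
  have hJabs : ∀ lam ∈ Set.Icc a b, ∀ u, ‖u‖ ≤ R₁ → |E₁ u - lam * E₂ u| ≤ K₁ + b * K₂ := by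
    intro lam hl u hu
    have h1 : |lam * E₂ u| ≤ b * K₂ := by
      rw [abs_mul, abs_of_pos (ha.trans_le hl.1)]
      exact mul_le_mul hl.2 (hK₂ u hu) (abs_nonneg _) hb.le
    exact (abs_sub _ _).trans (add_le_add (hK₁ u hu) h1)
  obtain ⟨R₂, hR₂⟩ := hcoer (K₁ + b * K₂ + 1)
  refine ⟨max R₂ 1, by positivity, fun lam hl E₃ hE₃C1 hE₃cpt => ?_⟩
  obtain ⟨T, hT, hTE, -⟩ := hE₁inv
  have hlam0 : 0 < lam := ha.trans_le hl.1
  have hd₁ := hE₁C1.differentiable one_ne_zero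
  have hd₂ := hE₂C1.differentiable one_ne_zero
  have hd₃ := hE₃C1.differentiable one_ne_zero
  let J : X → ℝ := fun u => E₁ u - lam * E₂ u
  have hJC1 : ContDiff ℝ 1 J := hE₁C1.sub (contDiff_const.mul hE₂C1)
  have hJd (u : X) : HasFDerivAt J (fderiv ℝ E₁ u - lam • fderiv ℝ E₂ u) u :=
    (hd₁ u).hasFDerivAt.sub ((hd₂ u).hasFDerivAt.const_mul lam)
  have hJb (C : ℝ) : IsBounded {u | J u ≤ C} := by
    obtain ⟨R, hR⟩ := hcoer C
    refine (Metric.isBounded_ball (x := (0 : X)) (r := R)).subset fun u hu => ?_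
    simpa using hR lam hl u hu
  have hJPS : PalaisSmaleBelow J :=
    palaisSmaleBelow_of_fderiv_eq_sub hT hTE
      (hE₂cpt.seqCompactMap.continuous_comp (continuous_const_smul lam))
      (fun u => (hJd u).fderiv) hJb
  have hJ₀ : J u₀ = 0 := by simp [J, hE₁u₀, hE₂u₀]
  obtain ⟨r, hr, hJpos⟩ : ∃ r > 0, ∀ u, u ≠ u₀ → dist u u₀ ≤ 3 * r → 0 < J u := by
    obtain ⟨U, hU, hUmin⟩ := hu₀min
    rw [eventually_nhdsWithin_iff] at hnear
    obtain ⟨ρ, hρ, hball⟩ := Metric.nhds_basis_closedBall.eventually_iff.1 (hnear.and hU)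
    refine ⟨ρ / 3, by positivity, fun u hu hdist => ?_⟩
    obtain ⟨h1, h2⟩ := hball (show u ∈ Metric.closedBall u₀ ρ from hdist.trans (by linarith))
    have h3 : 0 < E₁ u := hE₁u₀ ▸ hUmin u h2 hu
    exact (mul_pos hc0 h3).trans_le (hkey lam hl u h3 (h1 hu))
  obtain ⟨η, hη, hsphere⟩ := hJPS.exists_sphere_pos hJC1 hr hJpos
  obtain ⟨u₁, hu₁⟩ : ∃ u₁, J u₁ < 0 := by
    by_contra! h
    have h1 : χ ≤ ((1 / lam : ℝ) : EReal) := by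
      rw [hχ]
      refine iSup₂_le fun u hu => ?_
      have hu : 0 < E₁ u := hu
      have hJu : 0 ≤ E₁ u - lam * E₂ u := h u
      rw [EReal.coe_le_coe_iff, div_le_div_iff₀ hu hlam0]
      linarith
    have h2 : (lam : EReal) * χ ≤ lam * ((1 / lam : ℝ) : EReal) :=
      mul_le_mul_of_nonneg_left h1 (EReal.coe_nonneg.2 hlam0.le)
    rw [← EReal.coe_mul, mul_one_div_cancel hlam0.ne', EReal.coe_one] at h2
    exact h2.not_gt (hlam lam hl).1
  have hJL : ∀ u ∈ segment ℝ u₀ u₁, J u ≤ K₁ + b * K₂ := by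
    intro u hu
    have hmem : u ∈ Metric.closedBall (0 : X) R₁ :=
      (convex_closedBall (0 : X) R₁).segment_subset (by simp [hR₁])
        (by simpa [hR₁] using Or.inl (hR₀ lam hl u₁ hu₁.le).le) hu
    exact (le_abs_self _).trans (hJabs lam hl u (by simpa using hmem))
  have hJm (u : X) : -(K₁ + b * K₂) ≤ J u := by
    rcases le_or_gt (J u) 0 with h | h
    · exact (abs_le.1 (hJabs lam hl u ((hR₀ lam hl u h).le.trans (le_max_left _ _)))).1
    · have := hJL u₀ (left_mem_segment ℝ u₀ u₁)
      linarith
  obtain ⟨K₃, hK₃0, hK₃⟩ := hE₃cpt.exists_abs_le hd₃ (max R₂ 1)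
  obtain ⟨g, hgC1, ⟨C, hC0, hC⟩, hg', hg1⟩ :=
    exists_bounded_truncation (show 0 < K₃ + 1 by linarith)
  obtain ⟨ε, hε, hεη, hεu, hε1⟩ :
      ∃ ε > 0, 2 * ε < η ∧ J u₁ < -(2 * ε) ∧ 2 * ε ≤ 1 := by
    have h1 : 0 < min η (min (-J u₁) 1) := lt_min hη (lt_min (by linarith) one_pos)
    have h2 := min_le_left η (min (-J u₁) 1)
    have h3 := (min_le_right η (min (-J u₁) 1)).trans (min_le_left _ _)
    have h4 := (min_le_right η (min (-J u₁) 1)).trans (min_le_right _ _)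
    exact ⟨min η (min (-J u₁) 1) / 4, by linarith, by linarith, by linarith, by linarith⟩
  refine ⟨ε / (C + 1), by positivity, fun θ hθ => ?_⟩
  let G : X → ℝ := fun u => J u - θ * g (E₃ u)
  have hGC1 : ContDiff ℝ 1 G := hJC1.sub (contDiff_const.mul (hgC1.comp hE₃C1))
  have hGd (u : X) : fderiv ℝ G u = fderiv ℝ E₁ u -
      (lam • fderiv ℝ E₂ u + θ • deriv g (E₃ u) • fderiv ℝ E₃ u) := by
    have hg := (hgC1.differentiable one_ne_zero (E₃ u)).hasDerivAt
    rw [← sub_sub]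
    exact ((hJd u).sub ((hg.comp_hasFDerivAt u (hd₃ u).hasFDerivAt).const_mul θ)).fderiv
  have hGJ (u : X) : |G u - J u| ≤ ε := by
    have h1 : G u - J u = -(θ * g (E₃ u)) := by simp [G]
    rw [h1, abs_neg, abs_mul, abs_of_nonneg hθ.1]
    calc θ * |g (E₃ u)| ≤ ε / (C + 1) * (C + 1) :=
          mul_le_mul hθ.2 ((hC _).trans (by linarith)) (abs_nonneg _) (by positivity)
      _ = ε := div_mul_cancel₀ _ (by positivity)
  have hGPS : PalaisSmaleBelow G := by
    refine palaisSmaleBelow_of_fderiv_eq_sub hT hTE ?_ hGd fun c =>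
      (hJb (c + ε)).subset fun u (hu : G u ≤ c) => ?_
    · exact (hE₂cpt.seqCompactMap.prodMk
        ((SeqCompactMap.of_isCompact hg' fun u => ⟨E₃ u, rfl⟩).prodMk
          hE₃cpt.seqCompactMap)).continuous_comp
        (F := fun p : (X →L[ℝ] ℝ) × ℝ × (X →L[ℝ] ℝ) => lam • p.1 + θ • p.2.1 • p.2.2)
        (by fun_prop)
    · have := (abs_le.1 (hGJ u)).1
      show J u ≤ c + ε
      linarith
  have hball (u : X) (hu : dist u u₀ ≤ 2 * r) : 0 ≤ J u := by
    rcases eq_or_ne u u₀ with rfl | hne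
    · exact hJ₀.ge
    · exact (hJpos u hne (by linarith)).le
  obtain ⟨v₁, v₂, v₃, h₁₂, h₁₃, h₂₃, hv⟩ := exists_three_critical_points hGC1 hGPS
    (by positivity : 0 < 2 * r) hsphere hball hJ₀ hJL (m := -(K₁ + b * K₂) - ε)
    (fun u => by have := (abs_le.1 (hGJ u)).1; have := hJm u; linarith) hGJ hεη hεu
  refine ⟨v₁, v₂, v₃, h₁₂, h₁₃, h₂₃, fun v hvm => ?_⟩
  obtain ⟨hcrit, hle⟩ := hv v hvm
  have hnorm : ‖v‖ < max R₂ 1 := (hR₂ lam hl v (hle.trans (by linarith))).trans_le (le_max_left _ _)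
  have hv₃ := hK₃ v hnorm.le
  refine ⟨?_, hnorm⟩
  rw [hGd, hg1 _ (by linarith), one_smul, ← sub_sub] at hcrit
  exact hcrit
end
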